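/- arXiv:1312.0345 — 4 statements merged into one kernel-verified Lean document; each statement's English description precedes it below -/
import Mathlib

section
/- (Local classical solution by the method of characteristics) Let H : ℝⁿ × ℝⁿ → ℝ be C² with bounded second derivatives and let u₀ : ℝⁿ → ℝ be C² with bounded first and second derivatives. For each z ∈ ℝⁿ let (X(·,z), P(·,z)) be the solution of the characteristic system Ẋ = H_p(X,P), Ṗ = −H_x(X,P) with X(0,z) = z, P(0,z) = ∇u₀(z), and let U(·,z) solve U̇ = −H(X,P) + ⟨P, H_p(X,P)⟩ with U(0,z) = u₀(z). Then there exists T* > 0 such that for every t ∈ [0,T*) the map z ↦ X(t,z) is a bijection of ℝⁿ with C¹ inverse x ↦ Z(t,x), and the function u(t,x) := U(t, Z(t,x)) is of class C² on [0,T*) × ℝⁿ and is the unique C² solution of the Cauchy problem ∂u/∂t + H(x, ∇u(t,x)) = 0 on [0,T*) × ℝⁿ with u(0,x) = u₀(x). -/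
open Set Function
open scoped RealInnerProductSpace

noncomputable section

/-- Euclidean space `ℝⁿ`. -/
abbrev En (n : ℕ) := EuclideanSpace ℝ (Fin n)

section Auxiliary

open Filter Topology Metric

section Flow

variable {E V : Type*} [NormedAddCommGroup E] [NormedSpace ℝ E]
  [NormedAddCommGroup V] [NormedSpace ℝ V]

lemma gronwallBound_le {δ K ε x : ℝ} (hK : 0 ≤ K) (hε : 0 ≤ ε) :
    gronwallBound δ K ε x ≤ (δ + ε * x) * Real.exp (K * x) := by
  rcases hK.eq_or_lt with rfl | hK
  · simp [gronwallBound_K0]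
  · rw [gronwallBound_of_K_ne_0 hK.ne']
    have h : Real.exp (K * x) - 1 ≤ K * x * Real.exp (K * x) := by
      have h1 := Real.add_one_le_exp (-(K * x))
      have h2 : Real.exp (-(K * x)) * Real.exp (K * x) = 1 := by
        rw [← Real.exp_add]; simp
      nlinarith [Real.exp_pos (K * x)]
    have h3 : ε / K * (Real.exp (K * x) - 1) ≤ ε / K * (K * x * Real.exp (K * x)) := by gcongr
    have h4 : ε / K * (K * x * Real.exp (K * x)) = ε * x * Real.exp (K * x) := by field_simp
    linarith

/-- Two-sided Grönwall inequality around time `0`. -/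
lemma norm_le_of_norm_deriv_le {f f' : ℝ → E} {T δ K ε : ℝ} (hK : 0 ≤ K) (hε : 0 ≤ ε)
    (hf : ∀ t ∈ Ioo (-T) T, HasDerivAt f (f' t) t) (h0 : ‖f 0‖ ≤ δ)
    (bound : ∀ t ∈ Ioo (-T) T, ‖f' t‖ ≤ K * ‖f t‖ + ε) :
    ∀ t ∈ Ioo (-T) T, ‖f t‖ ≤ (δ + ε * T) * Real.exp (K * T) := by
  have forward : ∀ {h h' : ℝ → E}, (∀ t ∈ Ioo (-T) T, HasDerivAt h (h' t) t) → ‖h 0‖ ≤ δ →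
      (∀ t ∈ Ioo (-T) T, ‖h' t‖ ≤ K * ‖h t‖ + ε) →
      ∀ t ∈ Ico 0 T, ‖h t‖ ≤ (δ + ε * T) * Real.exp (K * T) := by
    intro h h' hh hh0 hb t ht
    have hsub : ∀ s ∈ Icc 0 t, s ∈ Ioo (-T) T := fun s hs =>
      ⟨by linarith [hs.1, ht.1, ht.2], by linarith [hs.2, ht.2]⟩
    have := norm_le_gronwallBound_of_norm_deriv_right_le
      (fun s hs => (hh s (hsub s hs)).continuousAt.continuousWithinAt)
      (fun s hs => (hh s (hsub s (Ico_subset_Icc_self hs))).hasDerivWithinAt) hh0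
      (fun s hs => hb s (hsub s (Ico_subset_Icc_self hs))) t ⟨ht.1, le_rfl⟩
    rw [sub_zero] at this
    have hδ : 0 ≤ δ := (norm_nonneg _).trans hh0
    have hT : 0 ≤ T := ht.1.trans ht.2.le
    refine this.trans ((gronwallBound_le hK hε).trans ?_)
    have := ht.2.le
    gcongr
  intro t ht
  rcases le_total 0 t with h | h
  · exact forward hf h0 bound t ⟨h, ht.2⟩
  · have neg : ∀ s ∈ Ioo (-T) T, -s ∈ Ioo (-T) T := fun s hs =>
      ⟨by linarith [hs.2], by linarith [hs.1]⟩
    simpa using forward (h := fun s => f (-s)) (h' := fun s => -f' (-s))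
      (fun s hs => by
        simpa [Function.comp_def] using (hf (-s) (neg s hs)).scomp s (hasDerivAt_neg s)) (by simpa using h0)
      (fun s hs => by simpa using bound (-s) (neg s hs)) (-t) ⟨by linarith, by linarith [ht.1]⟩

lemma exists_hasDerivAt_linear [CompleteSpace E] {B : ℝ → E →L[ℝ] E} (hB : Continuous B)
    {L T : ℝ} (hT : 0 < T) (hL : ∀ t, ‖B t‖ ≤ L) (hLT : 2 * L * T ≤ 1) (y₀ : E) :
    ∃ y : ℝ → E, y 0 = y₀ ∧ ∀ t ∈ Ioo (-T) T, HasDerivAt y (B t (y t)) t := by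
  have hL0 : 0 ≤ L := (norm_nonneg _).trans (hL 0)
  let a : NNReal := ‖y₀‖₊ + 1
  let L' : NNReal := ⟨L, hL0⟩
  have hpl : IsPicardLindelof (fun t y => B t y) (tmin := -T) (tmax := T)
      ⟨0, by constructor <;> linarith⟩ y₀ a 0 (L' * (2 * a)) L' := by
    refine ⟨fun t _ => ?_, fun x _ => ?_, fun t _ x hx => ?_, ?_⟩
    · exact ((B t).lipschitz.weaken (by exact_mod_cast hL t)).lipschitzOnWith
    · exact (hB.clm_apply continuous_const).continuousOn
    · have hx' : ‖x‖ ≤ 2 * a := by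
        have h1 := norm_le_of_mem_closedBall hx
        have h2 : ‖y₀‖ ≤ a := by simp [a]
        linarith
      push_cast
      exact (B t).le_of_opNorm_le_of_le (hL t) hx'
    · have : (0 : ℝ) ≤ a := a.2
      simp only [sub_zero, zero_sub, neg_neg, max_self, NNReal.coe_zero, NNReal.coe_mul]
      change L * (((2 : NNReal) : ℝ) * (a : ℝ)) * T ≤ a
      rw [NNReal.coe_ofNat]
      nlinarith
  obtain ⟨y, h0, hy⟩ := hpl.exists_eq_forall_mem_Icc_hasDerivWithinAt₀
  exact ⟨y, h0, fun t ht => (hy t (Ioo_subset_Icc_self ht)).hasDerivAt (Icc_mem_nhds ht.1 ht.2)⟩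

lemma IsCompact.exists_forall_norm_fderiv_sub_le {F : E → E} (hF : ContDiff ℝ 1 F) {s : Set E}
    (hs : IsCompact s) {ε : ℝ} (hε : 0 < ε) :
    ∃ δ > 0, ∀ a ∈ s, ∀ b, ‖b - a‖ < δ → ‖fderiv ℝ F b - fderiv ℝ F a‖ ≤ ε ∧
      ‖F b - F a - fderiv ℝ F a (b - a)‖ ≤ ε * ‖b - a‖ := by
  have hc : Continuous (fderiv ℝ F) := hF.continuous_fderiv one_ne_zero
  have := hs.uniformContinuousAt_of_continuousAt (fderiv ℝ F) (fun a _ => hc.continuousAt)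
    (dist_mem_uniformity hε)
  obtain ⟨δ, hδ, h⟩ := Metric.mem_uniformity_dist.1 this
  have key : ∀ a ∈ s, ∀ b, ‖b - a‖ < δ → ‖fderiv ℝ F b - fderiv ℝ F a‖ ≤ ε := by
    intro a ha b hb
    have := @h a b (by rwa [dist_comm, dist_eq_norm]) ha
    simp only [mem_ofPred_eq, dist_eq_norm] at this
    rw [norm_sub_rev]
    exact this.le
  refine ⟨δ, hδ, fun a ha b hb => ⟨key a ha b hb, ?_⟩⟩
  refine (convex_ball a δ).norm_image_sub_le_of_norm_hasFDerivWithin_le' (f' := fderiv ℝ F)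
    (fun x _ => ((hF.differentiable one_ne_zero) x).hasFDerivAt.hasFDerivWithinAt)
    (fun x hx => key a ha x (by rwa [mem_ball, dist_eq_norm] at hx))
    (mem_ball_self hδ) (by rwa [mem_ball, dist_eq_norm])

omit [NormedAddCommGroup V] [NormedSpace ℝ V] in
lemma norm_flow_sub_le {F : E → E} {L T : ℝ} (hL0 : 0 ≤ L)
    (hL : ∀ a b, ‖F a - F b‖ ≤ L * ‖a - b‖) {Φ : ℝ → V → E}
    (hΦ : ∀ t z, HasDerivAt (fun τ => Φ τ z) (F (Φ t z)) t) (z z' : V) :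
    ∀ t ∈ Ioo (-T) T, ‖Φ t z' - Φ t z‖ ≤ ‖Φ 0 z' - Φ 0 z‖ * Real.exp (L * T) := by
  intro t ht
  simpa using norm_le_of_norm_deriv_le (f := fun t => Φ t z' - Φ t z) hL0 le_rfl
    (fun t _ => (hΦ t z').sub (hΦ t z)) le_rfl (fun t _ => by simpa using hL _ _) t ht

/-- `C¹` dependence of the flow of a `C¹` vector field with bounded derivative on time and
parameters. -/
theorem contDiffOn_flow [CompleteSpace E] {F : E → E} {L M T : ℝ} (hF : ContDiff ℝ 1 F)
    (hFL : ∀ a, ‖fderiv ℝ F a‖ ≤ L) (hT : 0 < T) (hLT : 2 * L * T ≤ 1) {Φ : ℝ → V → E}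
    (hg : ContDiff ℝ 1 (Φ 0)) (hM0 : 0 < M) (hM : ∀ z z', ‖Φ 0 z' - Φ 0 z‖ ≤ M * ‖z' - z‖)
    (hΦ : ∀ t z, HasDerivAt (fun τ => Φ τ z) (F (Φ t z)) t) :
    ContDiffOn ℝ 1 (uncurry Φ) (Ioo (-T) T ×ˢ univ) := by
  have hL0 : 0 ≤ L := (norm_nonneg _).trans (hFL 0)
  have hFlip : ∀ a b, ‖F a - F b‖ ≤ L * ‖a - b‖ := fun a b =>
    convex_univ.norm_image_sub_le_of_norm_fderiv_le
      (fun x _ => hF.differentiable one_ne_zero x) (fun x _ => hFL x) (mem_univ b) (mem_univ a)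
  have hΦc : ∀ z, Continuous fun t => Φ t z := fun z =>
    continuous_iff_continuousAt.2 fun t => (hΦ t z).continuousAt
  have hF' : Continuous (fderiv ℝ F) := hF.continuous_fderiv one_ne_zero
  have hK : ∀ z, IsCompact ((fun t => Φ t z) '' Icc (-T) T) := fun z =>
    isCompact_Icc.image (hΦc z)
  have hmem : ∀ z, ∀ t ∈ Ioo (-T) T, Φ t z ∈ (fun t => Φ t z) '' Icc (-T) T := fun z t ht =>
    mem_image_of_mem _ (Ioo_subset_Icc_self ht)
  set e := Real.exp (L * T) with he
  have he0 : 0 < e := Real.exp_pos _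
  have hlip : ∀ z z', ∀ t ∈ Ioo (-T) T, ‖Φ t z' - Φ t z‖ ≤ M * e * ‖z' - z‖ := by
    intro z z' t ht
    calc _ ≤ ‖Φ 0 z' - Φ 0 z‖ * e := norm_flow_sub_le hL0 hFlip hΦ z z' t ht
      _ ≤ (M * ‖z' - z‖) * e := by gcongr; exact hM z z'
      _ = _ := by ring
  -- the solution of the linearized equation
  have hJ : ∀ z, ∃ J : ℝ → V →L[ℝ] E, J 0 = fderiv ℝ (Φ 0) z ∧
      ∀ t ∈ Ioo (-T) T, HasDerivAt J ((fderiv ℝ F (Φ t z)).comp (J t)) t := by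
    intro z
    refine exists_hasDerivAt_linear
      (B := fun t => ContinuousLinearMap.compL ℝ V E E (fderiv ℝ F (Φ t z))) (L := L)
      ((ContinuousLinearMap.compL ℝ V E E).continuous.comp (hF'.comp (hΦc z))) hT (fun t => ?_)
      hLT _
    refine ContinuousLinearMap.opNorm_le_bound _ hL0 fun A => ?_
    exact ((fderiv ℝ F (Φ t z)).opNorm_comp_le A).trans (by gcongr; exact hFL _)
  choose J hJ0 hJ using hJ
  have hJder : ∀ z, ∀ t ∈ Ioo (-T) T, HasFDerivAt (fun z => Φ t z) (J z t) z := by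
    intro z t ht
    rw [hasFDerivAt_iff_isLittleO, Asymptotics.isLittleO_iff]
    intro c hc
    set η : ℝ := c / (2 * e * (M * e * T + 1)) with hη
    have hη0 : 0 < η := by positivity
    obtain ⟨δ, hδ, hδF⟩ := (hK z).exists_forall_norm_fderiv_sub_le hF hη0
    have h1 := Asymptotics.isLittleO_iff.1
      (hasFDerivAt_iff_isLittleO.1 ((hg.differentiable one_ne_zero) z).hasFDerivAt) hη0
    have h2 : ∀ᶠ z' in 𝓝 z, M * e * ‖z' - z‖ < δ := by
      have : Tendsto (fun z' => M * e * ‖z' - z‖) (𝓝 z) (𝓝 (M * e * ‖z - z‖)) :=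
        (by fun_prop : Continuous fun z' => M * e * ‖z' - z‖).tendsto z
      rw [sub_self, norm_zero, mul_zero] at this
      exact this.eventually_lt_const hδ
    filter_upwards [h1, h2] with z' hz1 hz2
    have hG := norm_le_of_norm_deriv_le (f := fun t => Φ t z' - Φ t z - J z t (z' - z))
      (K := L) (ε := η * (M * e * ‖z' - z‖)) (δ := η * ‖z' - z‖) (T := T) hL0 (by positivity)
      (fun t ht => ((hΦ t z').sub (hΦ t z)).sub ((hJ z t ht).clm_apply (hasDerivAt_const t _)))
      (by rw [hJ0]; exact hz1) (fun s hs => by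
        have h3 := (hδF _ (hmem z s hs) (Φ s z') ((hlip z z' s hs).trans_lt hz2)).2
        have h4 : F (Φ s z') - F (Φ s z) - ((fderiv ℝ F (Φ s z)).comp (J z s)) (z' - z)
            = fderiv ℝ F (Φ s z) (Φ s z' - Φ s z - J z s (z' - z)) +
              (F (Φ s z') - F (Φ s z) - fderiv ℝ F (Φ s z) (Φ s z' - Φ s z)) := by
          simp only [map_sub, ContinuousLinearMap.comp_apply]; abel
        simp only [map_zero, add_zero]
        rw [h4]
        refine (norm_add_le _ _).trans (add_le_add ?_ (h3.trans ?_))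
        · exact (fderiv ℝ F (Φ s z)).le_of_opNorm_le (hFL _) _
        · gcongr; exact hlip z z' s hs) t ht
    refine hG.trans ?_
    have : (η * ‖z' - z‖ + η * (M * e * ‖z' - z‖) * T) * e = c / 2 * ‖z' - z‖ := by
      rw [hη]; field_simp; ring
    rw [← he, this]
    nlinarith [norm_nonneg (z' - z)]
  have hJcont : ∀ z₀, ∀ c > 0, ∀ᶠ z in 𝓝 z₀, ∀ t ∈ Ioo (-T) T, ‖J z t - J z₀ t‖ < c := by
    intro z₀ c hc
    set C : ℝ := ‖fderiv ℝ (Φ 0) z₀‖ * e with hC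
    have hC0 : 0 ≤ C := by positivity
    have hJb : ∀ t ∈ Ioo (-T) T, ‖J z₀ t‖ ≤ C := by
      intro t ht
      simpa using norm_le_of_norm_deriv_le (f := J z₀) hL0 le_rfl (hJ z₀) (by rw [hJ0])
        (fun t ht => by
          rw [add_zero]
          exact ((fderiv ℝ F _).opNorm_comp_le _).trans (by gcongr; exact hFL _)) t ht
    set η : ℝ := c / (2 * e * (C * T + 1)) with hη
    have hη0 : 0 < η := by positivity
    obtain ⟨δ, hδ, hδF⟩ := (hK z₀).exists_forall_norm_fderiv_sub_le hF hη0
    have h1 : ∀ᶠ z in 𝓝 z₀, ‖fderiv ℝ (Φ 0) z - fderiv ℝ (Φ 0) z₀‖ < η := by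
      have := Metric.tendsto_nhds.1 ((hg.continuous_fderiv one_ne_zero).tendsto z₀) η hη0
      simpa only [dist_eq_norm] using this
    have h2 : ∀ᶠ z' in 𝓝 z₀, M * e * ‖z' - z₀‖ < δ := by
      have : Tendsto (fun z' => M * e * ‖z' - z₀‖) (𝓝 z₀) (𝓝 (M * e * ‖z₀ - z₀‖)) :=
        (by fun_prop : Continuous fun z' => M * e * ‖z' - z₀‖).tendsto z₀
      rw [sub_self, norm_zero, mul_zero] at this
      exact this.eventually_lt_const hδ
    filter_upwards [h1, h2] with z hz1 hz2 t ht
    have hG := norm_le_of_norm_deriv_le (f := fun t => J z t - J z₀ t)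
      (K := L) (ε := η * C) (δ := η) (T := T) hL0 (by positivity)
      (fun t ht => (hJ z t ht).sub (hJ z₀ t ht))
      (by rw [hJ0, hJ0]; exact hz1.le) (fun s hs => by
        have h3 := (hδF _ (hmem z₀ s hs) (Φ s z) ((hlip z₀ z s hs).trans_lt hz2)).1
        have h4 : (fderiv ℝ F (Φ s z)).comp (J z s) - (fderiv ℝ F (Φ s z₀)).comp (J z₀ s)
            = (fderiv ℝ F (Φ s z)).comp (J z s - J z₀ s) +
              (fderiv ℝ F (Φ s z) - fderiv ℝ F (Φ s z₀)).comp (J z₀ s) := by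
          rw [ContinuousLinearMap.comp_sub, ContinuousLinearMap.sub_comp]; abel
        rw [h4]
        refine (norm_add_le _ _).trans (add_le_add ?_ ?_)
        · exact (ContinuousLinearMap.opNorm_comp_le _ _).trans (by gcongr; exact hFL _)
        · exact (ContinuousLinearMap.opNorm_comp_le _ _).trans (by gcongr; exact hJb s hs)) t ht
    refine hG.trans_lt ?_
    have : (η + η * C * T) * e = c / 2 := by
      rw [hη]; field_simp; ring
    rw [← he, this]
    linarith
  have hopen : IsOpen (Ioo (-T) T ×ˢ (univ : Set V)) := isOpen_Ioo.prod isOpen_univ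
  have hΦcont : ∀ q ∈ Ioo (-T) T ×ˢ (univ : Set V), ContinuousAt (uncurry Φ) q := by
    rintro ⟨t₀, z₀⟩ ⟨ht₀, -⟩
    have h1 : Tendsto (fun q : ℝ × V => uncurry Φ q - Φ q.1 z₀) (𝓝 (t₀, z₀)) (𝓝 0) := by
      refine squeeze_zero_norm' (a := fun q : ℝ × V => M * e * ‖q.2 - z₀‖) ?_ ?_
      · filter_upwards [hopen.mem_nhds (show (t₀, z₀) ∈ _ from ⟨ht₀, mem_univ _⟩)] with q hq
        exact hlip _ _ _ hq.1
      · have := (by fun_prop : Continuous fun q : ℝ × V => M * e * ‖q.2 - z₀‖).tendsto (t₀, z₀)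
        simpa using this
    have h2 : Tendsto (fun q : ℝ × V => Φ q.1 z₀) (𝓝 (t₀, z₀)) (𝓝 (Φ t₀ z₀)) :=
      ((hΦc z₀).comp continuous_fst).tendsto (t₀, z₀)
    simpa [ContinuousAt] using h1.add h2
  have hJcont' : ∀ q ∈ Ioo (-T) T ×ˢ (univ : Set V),
      ContinuousAt (uncurry fun t z => J z t) q := by
    rintro ⟨t₀, z₀⟩ ⟨ht₀, -⟩
    have h1 : Tendsto (fun q : ℝ × V => J q.2 q.1 - J z₀ q.1) (𝓝 (t₀, z₀)) (𝓝 0) := by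
      rw [Metric.tendsto_nhds]
      intro c hc
      have h3 : ∀ᶠ q : ℝ × V in 𝓝 (t₀, z₀), ∀ t ∈ Ioo (-T) T, ‖J q.2 t - J z₀ t‖ < c :=
        (continuous_snd.tendsto (t₀, z₀)).eventually (hJcont z₀ c hc)
      filter_upwards [h3, hopen.mem_nhds (show (t₀, z₀) ∈ _ from ⟨ht₀, mem_univ _⟩)] with q h hq
      simpa using h q.1 hq.1
    have h2 : Tendsto (fun q : ℝ × V => J z₀ q.1) (𝓝 (t₀, z₀)) (𝓝 (J z₀ t₀)) :=
      (hJ z₀ t₀ ht₀).continuousAt.tendsto.comp continuous_fst.continuousAt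
    have h3 := h1.add h2
    simp only [sub_add_cancel, zero_add] at h3
    exact h3
  have hFcont : ∀ q ∈ Ioo (-T) T ×ˢ (univ : Set V), ContinuousAt
      (uncurry fun t z => ContinuousLinearMap.toSpanSingleton ℝ (F (Φ t z))) q := by
    intro q hq
    exact ((ContinuousLinearMap.toSpanSingletonCLE (𝕜 := ℝ) (E := E)).continuous.comp
      hF.continuous).continuousAt.comp (hΦcont q hq)
  have hder : ∀ q ∈ Ioo (-T) T ×ˢ (univ : Set V), HasFDerivAt (uncurry Φ)
      ((ContinuousLinearMap.toSpanSingleton ℝ (F (Φ q.1 q.2))).coprod (J q.2 q.1)) q := by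
    intro q hq
    exact (hasStrictFDerivAt_uncurry_coprod (f := Φ)
      (f₁ := fun t z => ContinuousLinearMap.toSpanSingleton ℝ (F (Φ t z)))
      (f₂ := fun t z => J z t) (Eventually.of_forall fun q => (hΦ q.1 q.2).hasFDerivAt)
      (by filter_upwards [hopen.mem_nhds hq] with q hq using hJder q.2 q.1 hq.1)
      (hFcont q hq) (hJcont' q hq)).hasFDerivAt
  have := (contDiffOn_succ_iff_hasFDerivWithinAt_of_uniqueDiffOn (𝕜 := ℝ) (n := 0)
    (f := uncurry Φ) hopen.uniqueDiffOn).2 ⟨by simp, _, ?_,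
      fun q hq => (hder q hq).hasFDerivWithinAt⟩
  · simpa using this
  · rw [contDiffOn_zero]
    intro q hq
    simp only [← ContinuousLinearMap.comp_fst_add_comp_snd]
    exact (((hFcont q hq).clm_comp continuousAt_const).add
      ((hJcont' q hq).clm_comp continuousAt_const)).continuousWithinAt

end Flow

section Inverse

variable {V : Type*} [NormedAddCommGroup V] [NormedSpace ℝ V] [CompleteSpace V]

lemma bijective_of_norm_sub_sub_le {f : V → V}
    (hf : ∀ z z', ‖f z - f z' - (z - z')‖ ≤ 1 / 2 * ‖z - z'‖) : Bijective f := by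
  have h : ApproximatesLinearOn f ((ContinuousLinearEquiv.refl ℝ V : V ≃L[ℝ] V) : V →L[ℝ] V) univ
      (1 / 2 : NNReal) := fun x _ y _ => by simpa using hf x y
  have hc : Subsingleton V ∨ (1 / 2 : NNReal) <
      ‖((ContinuousLinearEquiv.refl ℝ V).symm : V →L[ℝ] V)‖₊⁻¹ := by
    rcases subsingleton_or_nontrivial V with hV | hV
    · exact Or.inl hV
    · right
      have h1 : ‖((ContinuousLinearEquiv.refl ℝ V).symm : V →L[ℝ] V)‖₊ = 1 :=
        NNReal.eq ContinuousLinearMap.norm_id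
      rw [h1, inv_one]
      exact NNReal.half_lt_self one_ne_zero
  exact ⟨injOn_univ.1 (h.injOn hc), h.surjective hc⟩

/-- A `C¹` family of `1/2`-perturbations of the identity has a `C¹` family of inverses. -/
theorem exists_contDiffOn_inverse {X : ℝ → V → V} {s : Set ℝ} (hs : IsOpen s)
    (hX : ContDiffOn ℝ 1 (uncurry X) (s ×ˢ univ))
    (hlip : ∀ t ∈ s, ∀ z z', ‖X t z - X t z' - (z - z')‖ ≤ 1 / 2 * ‖z - z'‖) :
    ∃ Z : ℝ → V → V, (∀ t ∈ s, LeftInverse (Z t) (X t) ∧ RightInverse (Z t) (X t)) ∧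
      ContDiffOn ℝ 1 (uncurry Z) (s ×ˢ univ) := by
  have hbij : ∀ t ∈ s, Bijective (X t) := fun t ht => bijective_of_norm_sub_sub_le (hlip t ht)
  have hopen : IsOpen (s ×ˢ (univ : Set V)) := hs.prod isOpen_univ
  have hinv : ∀ t ∈ s, LeftInverse (invFun (X t)) (X t) ∧ RightInverse (invFun (X t)) (X t) :=
    fun t ht => ⟨leftInverse_invFun (hbij t ht).1, rightInverse_invFun (hbij t ht).2⟩
  refine ⟨fun t => invFun (X t), hinv, ?_⟩
  rintro ⟨t, x⟩ ⟨ht, -⟩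
  refine ContDiffAt.contDiffWithinAt ?_
  obtain ⟨z, rfl⟩ := (hbij t ht).2 x
  let Ψ : ℝ × V → ℝ × V := fun q => (q.1, uncurry X q)
  have hq : (t, z) ∈ s ×ˢ (univ : Set V) := ⟨ht, mem_univ _⟩
  have hXat : ContDiffAt ℝ 1 (uncurry X) (t, z) := hX.contDiffAt (hopen.mem_nhds hq)
  have hΨ : ContDiffAt ℝ 1 Ψ (t, z) := contDiffAt_fst.prodMk hXat
  set D := fderiv ℝ (uncurry X) (t, z)
  have hD : HasFDerivAt (uncurry X) D (t, z) :=
    (hXat.differentiableAt one_ne_zero).hasFDerivAt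
  set B : V →L[ℝ] V := D.comp (ContinuousLinearMap.inr ℝ ℝ V)
  have hB : HasFDerivAt (X t) B z :=
    HasFDerivAt.comp (g := uncurry X) z hD (hasFDerivAt_prodMk_right t z)
  have hB1 : ‖1 - B‖ < 1 := by
    have : ‖1 - B‖ ≤ 1 / 2 := by
      rw [norm_sub_rev]
      refine (hB.sub (hasFDerivAt_id z)).le_of_lip' (by norm_num) ?_
      filter_upwards with y
      have := hlip t ht y z
      simp only [Pi.sub_apply, id]
      convert this using 2
      abel
    linarith
  obtain ⟨e, he⟩ : IsUnit B := by simpa using isUnit_one_sub_of_norm_lt_one hB1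
  let e' : (ℝ × V) ≃L[ℝ] (ℝ × V) :=
    (ContinuousLinearEquiv.refl ℝ ℝ).skewProd (ContinuousLinearEquiv.ofUnit e)
      (D.comp (ContinuousLinearMap.inl ℝ ℝ V))
  have hΨ' : HasFDerivAt Ψ (e' : (ℝ × V) →L[ℝ] (ℝ × V)) (t, z) := by
    refine (hasFDerivAt_fst.prodMk hD).congr_fderiv ?_
    ext q
    · simp [e']
    · simp [e']
    · simp [e']
    · have : (e : V →L[ℝ] V) q = B q := by rw [he]
      simp only [e', ContinuousLinearMap.comp_apply, ContinuousLinearMap.inr_apply,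
        ContinuousLinearMap.prod_apply, ContinuousLinearEquiv.coe_coe,
        ContinuousLinearEquiv.skewProd_apply, map_zero, add_zero]
      exact this.symm
  refine (hΨ.to_localInverse hΨ' one_ne_zero).snd.congr_of_eventuallyEq ?_
  have hst := hΨ.hasStrictFDerivAt' hΨ' one_ne_zero
  have h1 := hst.eventually_right_inverse
  have h2 : ∀ᶠ y in 𝓝 (Ψ (t, z)), hΨ.localInverse hΨ' one_ne_zero y ∈ s ×ˢ (univ : Set V) := by
    refine (hΨ.to_localInverse hΨ' one_ne_zero).continuousAt.eventually ?_
    rw [hΨ.localInverse_apply_image]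
    exact hopen.mem_nhds hq
  filter_upwards [h1, h2] with y hy1 hy2
  change invFun (X y.1) y.2 = (hst.localInverse Ψ _ _ y).2
  have h3 : (hst.localInverse Ψ _ _ y).1 = y.1 :=
    (congrArg Prod.fst hy1 : (Ψ (hst.localInverse Ψ _ _ y)).1 = y.1)
  have h4 : X (hst.localInverse Ψ _ _ y).1 (hst.localInverse Ψ _ _ y).2 = y.2 :=
    (congrArg Prod.snd hy1 : (Ψ (hst.localInverse Ψ _ _ y)).2 = y.2)
  have h5 : (hst.localInverse Ψ _ _ y).1 ∈ s := hy2.1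
  rw [h3] at h4 h5
  rw [← h4]
  exact (hinv _ h5).1 _

end Inverse

section Hamiltonian

variable {V : Type*} [NormedAddCommGroup V] [InnerProductSpace ℝ V] [CompleteSpace V]

variable (V) in
/-- The inverse of the Riesz isomorphism of a real Hilbert space, as a linear map. -/
def rieszInv : (V →L[ℝ] ℝ) →L[ℝ] V where
  toFun l := (InnerProductSpace.toDual ℝ V).symm l
  map_add' := by simp
  map_smul' := by simp
  cont := (InnerProductSpace.toDual ℝ V).symm.continuous

lemma inner_rieszInv (l : V →L[ℝ] ℝ) (y : V) : ⟪rieszInv V l, y⟫ = l y :=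
  InnerProductSpace.toDual_symm_apply

lemma gradient_eq_rieszInv {f : V → ℝ} {l : V →L[ℝ] ℝ} {x : V} (h : HasFDerivAt f l x) :
    gradient f x = rieszInv V l := by
  rw [gradient, h.fderiv]; rfl

lemma gradient_eq_of_hasFDerivAt_innerSL {f : V → ℝ} {y x : V}
    (h : HasFDerivAt f (innerSL ℝ y) x) : gradient f x = y := by
  refine ext_inner_right ℝ fun w => ?_
  rw [gradient_eq_rieszInv h, inner_rieszInv, innerSL_apply_apply]

/-- The Hamiltonian vector field `(H_p, -H_x)`. -/
def hamiltonianField (H : V → V → ℝ) (q : V × V) : V × V :=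
  (gradient (fun p => H q.1 p) q.2, -gradient (fun x => H x q.2) q.1)

variable {H : V → V → ℝ}

omit [CompleteSpace V] in
lemma hasFDerivAt_partial_left {D : V × V →L[ℝ] ℝ} {x p : V}
    (h : HasFDerivAt (fun q : V × V => H q.1 q.2) D (x, p)) :
    HasFDerivAt (fun x => H x p) (D.comp (ContinuousLinearMap.inl ℝ V V)) x :=
  HasFDerivAt.comp (f := fun e : V => (e, p)) (g := fun q : V × V => H q.1 q.2) x h
    (hasFDerivAt_prodMk_left x p)

omit [CompleteSpace V] in
lemma hasFDerivAt_partial_right {D : V × V →L[ℝ] ℝ} {x p : V}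
    (h : HasFDerivAt (fun q : V × V => H q.1 q.2) D (x, p)) :
    HasFDerivAt (fun p => H x p) (D.comp (ContinuousLinearMap.inr ℝ V V)) p :=
  HasFDerivAt.comp (f := fun e : V => (x, e)) (g := fun q : V × V => H q.1 q.2) p h
    (hasFDerivAt_prodMk_right x p)

lemma fderiv_hamiltonian_apply {x p : V}
    (h : DifferentiableAt ℝ (fun q : V × V => H q.1 q.2) (x, p)) (a b : V) :
    fderiv ℝ (fun q : V × V => H q.1 q.2) (x, p) (a, b) =
      ⟪gradient (fun x => H x p) x, a⟫ + ⟪gradient (fun p => H x p) p, b⟫ := by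
  rw [gradient_eq_rieszInv (hasFDerivAt_partial_left h.hasFDerivAt),
    gradient_eq_rieszInv (hasFDerivAt_partial_right h.hasFDerivAt), inner_rieszInv, inner_rieszInv]
  simp [← map_add]

lemma exists_hamiltonianField_eq (h : Differentiable ℝ (fun q : V × V => H q.1 q.2)) :
    ∃ A : (V × V →L[ℝ] ℝ) →L[ℝ] V × V, ∀ q,
      hamiltonianField H q = A (fderiv ℝ (fun q : V × V => H q.1 q.2) q) := by
  let cl : (V × V →L[ℝ] ℝ) →L[ℝ] (V →L[ℝ] ℝ) :=
    (ContinuousLinearMap.compL ℝ V (V × V) ℝ).flip (ContinuousLinearMap.inl ℝ V V)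
  let cr : (V × V →L[ℝ] ℝ) →L[ℝ] (V →L[ℝ] ℝ) :=
    (ContinuousLinearMap.compL ℝ V (V × V) ℝ).flip (ContinuousLinearMap.inr ℝ V V)
  refine ⟨((rieszInv V).comp cr).prod (-((rieszInv V).comp cl)), fun q => ?_⟩
  have hq := (h q).hasFDerivAt
  rw [hamiltonianField, gradient_eq_rieszInv (hasFDerivAt_partial_right (x := q.1) hq),
    gradient_eq_rieszInv (hasFDerivAt_partial_left (p := q.2) hq)]
  rfl

lemma norm_fderiv_fderiv_le {E : Type*} [NormedAddCommGroup E] [NormedSpace ℝ E] {f : E → ℝ}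
    {C : ℝ} (hC : ∀ x, ‖iteratedFDeriv ℝ 2 f x‖ ≤ C) (x : E) :
    ‖fderiv ℝ (fderiv ℝ f) x‖ ≤ C := by
  have := hC x
  rwa [← norm_iteratedFDeriv_fderiv, norm_iteratedFDeriv_one] at this

/-- A quadratic Taylor estimate from a Lipschitz bound on the derivative. -/
lemma abs_sub_sub_fderiv_le {E : Type*} [NormedAddCommGroup E] [NormedSpace ℝ E] {f : E → ℝ}
    {C : ℝ} (hf : ContDiff ℝ 2 f) (hC : ∀ x, ‖iteratedFDeriv ℝ 2 f x‖ ≤ C) (a b : E) :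
    |f b - f a - fderiv ℝ f a (b - a)| ≤ C * ‖b - a‖ ^ 2 := by
  have hC0 : 0 ≤ C := (norm_nonneg _).trans (hC a)
  have hd : ContDiff ℝ 1 (fderiv ℝ f) := hf.fderiv_right (by norm_num)
  have h1 : ∀ x ∈ segment ℝ a b, ‖fderiv ℝ f x - fderiv ℝ f a‖ ≤ C * ‖b - a‖ := by
    intro x hx
    have h2 := convex_univ.norm_image_sub_le_of_norm_fderiv_le
      (fun x _ => hd.differentiable one_ne_zero x) (fun x _ => norm_fderiv_fderiv_le hC x)
      (mem_univ a) (mem_univ x)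
    refine h2.trans ?_
    gcongr
    exact norm_sub_le_of_mem_segment hx
  have h3 := (convex_segment a b).norm_image_sub_le_of_norm_hasFDerivWithin_le'
    (fun x _ => ((hf.differentiable two_ne_zero) x).hasFDerivAt.hasFDerivWithinAt) h1
    (left_mem_segment ℝ a b) (right_mem_segment ℝ a b)
  rw [Real.norm_eq_abs] at h3
  linarith

lemma contDiff_hamiltonianField (hH : ContDiff ℝ 2 fun q : V × V => H q.1 q.2) :
    ContDiff ℝ 1 (hamiltonianField H) := by
  obtain ⟨A, hA⟩ := exists_hamiltonianField_eq (hH.differentiable two_ne_zero)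
  rw [funext hA]
  have hd : ContDiff ℝ 1 (fderiv ℝ fun q : V × V => H q.1 q.2) := hH.fderiv_right (by norm_num)
  exact A.contDiff.comp hd

lemma exists_norm_fderiv_clm_comp_le {E F G : Type*} [NormedAddCommGroup E] [NormedSpace ℝ E]
    [NormedAddCommGroup F] [NormedSpace ℝ F] [NormedAddCommGroup G] [NormedSpace ℝ G]
    (A : F →L[ℝ] G) {d : E → F} {C : ℝ} (hd : Differentiable ℝ d) (hC : ∀ x, ‖fderiv ℝ d x‖ ≤ C) :
    ∃ L, 0 < L ∧ ∀ x, ‖fderiv ℝ (fun y => A (d y)) x‖ ≤ L := by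
  have hC0 : 0 ≤ C := (norm_nonneg _).trans (hC 0)
  refine ⟨‖A‖ * C + 1, by positivity, fun x => ?_⟩
  have h1 : HasFDerivAt (fun y => A (d y)) (A.comp (fderiv ℝ d x)) x :=
    A.hasFDerivAt.comp x (hd x).hasFDerivAt
  rw [h1.fderiv]
  have h := (A.opNorm_comp_le (fderiv ℝ d x)).trans
    (mul_le_mul_of_nonneg_left (hC x) (norm_nonneg A))
  linarith

lemma exists_norm_fderiv_hamiltonianField_le (hH : ContDiff ℝ 2 fun q : V × V => H q.1 q.2) {C : ℝ}
    (hC : ∀ q, ‖iteratedFDeriv ℝ 2 (fun q : V × V => H q.1 q.2) q‖ ≤ C) :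
    ∃ L, 0 < L ∧ ∀ q, ‖fderiv ℝ (hamiltonianField H) q‖ ≤ L := by
  obtain ⟨A, hA⟩ := exists_hamiltonianField_eq (hH.differentiable two_ne_zero)
  have hd : ContDiff ℝ 1 (fderiv ℝ fun q : V × V => H q.1 q.2) := hH.fderiv_right (by norm_num)
  have h1 := norm_fderiv_fderiv_le hC
  have h2 := exists_norm_fderiv_clm_comp_le A (hd.differentiable one_ne_zero) h1
  rw [funext hA]
  exact h2

lemma norm_image_sub_le_of_norm_fderiv_le' {E G : Type*} [NormedAddCommGroup E] [NormedSpace ℝ E]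
    [NormedAddCommGroup G] [NormedSpace ℝ G] {f : E → G} {C : ℝ} (hf : Differentiable ℝ f)
    (hC : ∀ x, ‖fderiv ℝ f x‖ ≤ C) (a b : E) : ‖f a - f b‖ ≤ C * ‖a - b‖ :=
  convex_univ.norm_image_sub_le_of_norm_fderiv_le (fun x _ => hf x) (fun x _ => hC x)
    (mem_univ b) (mem_univ a)

/-- Along the characteristics, the action is given to second order by the momentum. -/
theorem exists_abs_action_sub_le {u₀ : V → ℝ} {C C₀ L K T : ℝ}
    (hH : ContDiff ℝ 2 fun q : V × V => H q.1 q.2)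
    (hC : ∀ q, ‖iteratedFDeriv ℝ 2 (fun q : V × V => H q.1 q.2) q‖ ≤ C)
    (hL0 : 0 ≤ L)
    (hL : ∀ a b, ‖hamiltonianField H a - hamiltonianField H b‖ ≤ L * ‖a - b‖)
    (hu₀ : ContDiff ℝ 2 u₀) (hC₀ : ∀ z, ‖iteratedFDeriv ℝ 2 u₀ z‖ ≤ C₀) (hT : 0 < T)
    {X P : ℝ → V → V} {W : ℝ → V → ℝ}
    (hX0 : ∀ z, X 0 z = z) (hP0 : ∀ z, P 0 z = gradient u₀ z) (hW0 : ∀ z, W 0 z = u₀ z)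
    (hX : ∀ t z, HasDerivAt (fun τ => X τ z) (gradient (fun p => H (X t z) p) (P t z)) t)
    (hP : ∀ t z, HasDerivAt (fun τ => P τ z) (-gradient (fun x => H x (P t z)) (X t z)) t)
    (hW : ∀ t z, HasDerivAt (fun τ => W τ z)
      (-(H (X t z) (P t z)) + ⟪P t z, gradient (fun p => H (X t z) p) (P t z)⟫) t)
    (hK : ∀ t ∈ Ioo (-T) T, ∀ z z',
      ‖((X t z', P t z') : V × V) - (X t z, P t z)‖ ≤ K * ‖z' - z‖) :
    ∃ Q ≥ 0, ∀ t ∈ Ioo (-T) T, ∀ z z',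
      |W t z' - W t z - ⟪P t z, X t z' - X t z⟫| ≤ Q * ‖z' - z‖ ^ 2 := by
  have hC0 : 0 ≤ C := (norm_nonneg _).trans (hC 0)
  have hC₀0 : 0 ≤ C₀ := (norm_nonneg _).trans (hC₀ 0)
  refine ⟨C₀ + (C + L) * K ^ 2 * T, by positivity, fun t ht z z' => ?_⟩
  have h := norm_le_of_norm_deriv_le
    (f := fun t => W t z' - W t z - ⟪P t z, X t z' - X t z⟫) (K := 0)
    (ε := (C + L) * K ^ 2 * ‖z' - z‖ ^ 2) (δ := C₀ * ‖z' - z‖ ^ 2) (T := T) le_rfl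
    (by positivity)
    (fun t _ => ((hW t z').sub (hW t z)).sub ((hP t z).inner ℝ ((hX t z').sub (hX t z))))
    (by
      have := abs_sub_sub_fderiv_le hu₀ hC₀ z z'
      rw [hW0, hW0, hX0, hX0, hP0, inner_gradient_left]
      exact this)
    (fun s hs => ?_) t ht
  · simp only [zero_mul, Real.exp_zero, mul_one, Real.norm_eq_abs] at h
    linarith
  · have hb := hK s hs z z'
    set x := X s z
    set p := P s z
    set x' := X s z'
    set p' := P s z'
    have h1 := abs_sub_sub_fderiv_le hH hC (x, p) (x', p')
    rw [Prod.mk_sub_mk, fderiv_hamiltonian_apply (hH.differentiable two_ne_zero _),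
      ← Prod.mk_sub_mk] at h1
    have h2 : |⟪p' - p, gradient (fun p => H x' p) p' - gradient (fun p => H x p) p⟫| ≤
        L * ‖((x', p') : V × V) - (x, p)‖ ^ 2 := by
      have h3 : ‖gradient (fun p => H x' p) p' - gradient (fun p => H x p) p‖ ≤
          L * ‖((x', p') : V × V) - (x, p)‖ :=
        (norm_fst_le (hamiltonianField H (x', p') - hamiltonianField H (x, p))).trans (hL _ _)
      have h4 : ‖p' - p‖ ≤ ‖((x', p') : V × V) - (x, p)‖ :=
        norm_snd_le (((x', p') : V × V) - (x, p))
      calc _ ≤ _ := abs_real_inner_le_norm _ _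
        _ ≤ ‖((x', p') : V × V) - (x, p)‖ * (L * ‖((x', p') : V × V) - (x, p)‖) := by gcongr
        _ = _ := by ring
    have h5 : ‖((x', p') : V × V) - (x, p)‖ ^ 2 ≤ (K * ‖z' - z‖) ^ 2 := by gcongr
    have h6 : (-H x' p' + ⟪p', gradient (fun p => H x' p) p'⟫ -
        (-H x p + ⟪p, gradient (fun p => H x p) p⟫) -
        (⟪p, gradient (fun p => H x' p) p' - gradient (fun p => H x p) p⟫ +
          ⟪-gradient (fun x => H x p) x, x' - x⟫)) =
        ⟪p' - p, gradient (fun p => H x' p) p' - gradient (fun p => H x p) p⟫ -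
        (H x' p' - H x p - (⟪gradient (fun x => H x p) x, x' - x⟫ +
          ⟪gradient (fun p => H x p) p, p' - p⟫)) := by
      rw [real_inner_comm (p' - p) (gradient (fun p => H x p) p)]
      simp only [inner_sub_left, inner_sub_right, inner_neg_left]
      ring
    rw [zero_mul, zero_add, Real.norm_eq_abs, h6]
    refine (abs_sub _ _).trans ((add_le_add h2 h1).trans ?_)
    calc _ = (C + L) * ‖((x', p') : V × V) - (x, p)‖ ^ 2 := by ring
      _ ≤ (C + L) * (K * ‖z' - z‖) ^ 2 := by gcongr
      _ = _ := by ring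

end Hamiltonian

section Action

lemma hasFDerivAt_of_norm_sub_le_sq {E F G : Type*} [NormedAddCommGroup E] [NormedSpace ℝ E]
    [NormedAddCommGroup F] [NormedSpace ℝ F] [NormedAddCommGroup G] [NormedSpace ℝ G]
    {f g : E → F} {k : E → G} {g' : E →L[ℝ] F} {x : E} {C : ℝ} (hg : HasFDerivAt g g' x)
    (hk : DifferentiableAt ℝ k x) (hkx : k x = 0)
    (h : ∀ᶠ y in 𝓝 x, ‖f y - g y‖ ≤ C * ‖k y‖ ^ 2) : HasFDerivAt f g' x := by
  have hfx : f x - g x = 0 := by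
    have := h.self_of_nhds
    rw [hkx, norm_zero, zero_pow two_ne_zero, mul_zero] at this
    exact norm_le_zero_iff.1 this
  have h1 : k =O[𝓝 x] fun y => y - x := by
    simpa [hkx] using hk.isBigO_sub
  have h2 : (fun y => f y - g y) =o[𝓝 x] fun y => y - x := by
    have h3 : (fun y => f y - g y) =O[𝓝 x] fun y => ‖k y‖ ^ 2 := by
      refine Asymptotics.IsBigO.of_bound C ?_
      simpa using h
    refine h3.trans_isLittleO ((h1.norm_norm.pow 2).trans_isLittleO ?_)
    refine (Asymptotics.isLittleO_pow_sub_sub x one_lt_two).congr_left ?_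
    simp
  have h4 : HasFDerivAt (fun y => f y - g y) (0 : E →L[ℝ] F) x := by
    refine HasFDerivAt.of_isLittleO ?_
    simpa [hfx] using h2
  have h5 := h4.add hg
  rw [zero_add] at h5
  exact h5.congr_of_eventuallyEq (by filter_upwards with y; simp)

variable {V : Type*} [NormedAddCommGroup V] [InnerProductSpace ℝ V]

/-- The differential of the solution given by the characteristics. -/
theorem hasFDerivAt_action [CompleteSpace V] {H : V → V → ℝ} {Q : ℝ} {s : Set ℝ} (hs : IsOpen s)
    {X P Z : ℝ → V → V} {W : ℝ → V → ℝ}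
    (hX : ∀ t z, HasDerivAt (fun τ => X τ z) (gradient (fun p => H (X t z) p) (P t z)) t)
    (hP : ∀ t z, HasDerivAt (fun τ => P τ z) (-gradient (fun x => H x (P t z)) (X t z)) t)
    (hW : ∀ t z, HasDerivAt (fun τ => W τ z)
      (-(H (X t z) (P t z)) + ⟪P t z, gradient (fun p => H (X t z) p) (P t z)⟫) t)
    (hlip : ∀ t ∈ s, ∀ z z', ‖X t z - X t z' - (z - z')‖ ≤ 1 / 2 * ‖z - z'‖)
    (hZ : ∀ t ∈ s, RightInverse (Z t) (X t))
    (hQ0 : 0 ≤ Q)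
    (hQ : ∀ t ∈ s, ∀ z z', |W t z' - W t z - ⟪P t z, X t z' - X t z⟫| ≤ Q * ‖z' - z‖ ^ 2)
    {t : ℝ} (ht : t ∈ s) (x : V) :
    HasFDerivAt (fun q : ℝ × V => W q.1 (Z q.1 q.2))
      ((innerSL ℝ (P t (Z t x))).comp (ContinuousLinearMap.snd ℝ ℝ V) -
        H x (P t (Z t x)) • ContinuousLinearMap.fst ℝ ℝ V) (t, x) := by
  obtain ⟨z, hz⟩ : ∃ z, z = Z t x := ⟨_, rfl⟩
  have hXz : X t z = x := by rw [hz, hZ t ht x]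
  rw [← hz]
  have hf : HasFDerivAt (fun q : ℝ × V => q.1) (ContinuousLinearMap.fst ℝ ℝ V) (t, x) :=
    hasFDerivAt_fst
  have hX' : HasFDerivAt (fun q : ℝ × V => X q.1 z) _ (t, x) :=
    ((hX t z).hasFDerivAt.comp (t, x) hf :)
  have hP' : HasFDerivAt (fun q : ℝ × V => P q.1 z) _ (t, x) :=
    ((hP t z).hasFDerivAt.comp (t, x) hf :)
  have hW' : HasFDerivAt (fun q : ℝ × V => W q.1 z) _ (t, x) :=
    ((hW t z).hasFDerivAt.comp (t, x) hf :)
  have hk : HasFDerivAt (fun q : ℝ × V => q.2 - X q.1 z) _ (t, x) := hasFDerivAt_snd.sub hX'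
  refine hasFDerivAt_of_norm_sub_le_sq (k := fun q : ℝ × V => q.2 - X q.1 z) (C := 4 * Q)
    (((hP'.inner ℝ hk).add hW').congr_fderiv ?_) hk.differentiableAt (by simp [hXz]) ?_
  · ext q
    all_goals simp [hXz]
  · have hU : s ×ˢ (univ : Set V) ∈ 𝓝 (t, x) :=
      (hs.prod isOpen_univ).mem_nhds ⟨ht, mem_univ _⟩
    filter_upwards [hU] with q hq
    have h1 := hQ q.1 hq.1 z (Z q.1 q.2)
    have h2 := hlip q.1 hq.1 (Z q.1 q.2) z
    rw [hZ q.1 hq.1 q.2] at h1 h2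
    have h3 : ‖Z q.1 q.2 - z‖ ≤ 2 * ‖q.2 - X q.1 z‖ := by
      have := norm_sub_norm_le (Z q.1 q.2 - z) (q.2 - X q.1 z)
      rw [norm_sub_rev (Z q.1 q.2 - z) (q.2 - X q.1 z)] at this
      linarith
    calc _ = |W q.1 (Z q.1 q.2) - W q.1 z - ⟪P q.1 z, q.2 - X q.1 z⟫| := by
          rw [Real.norm_eq_abs, Pi.add_apply]; congr 1; ring
      _ ≤ Q * ‖Z q.1 q.2 - z‖ ^ 2 := h1
      _ ≤ Q * (2 * ‖q.2 - X q.1 z‖) ^ 2 := by gcongr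
      _ = _ := by ring

/-- A function with `C¹` momentum whose differential is `p dx - H(x, p) dt` is `C²`. -/
lemma contDiffOn_two_of_hasFDerivAt {H : V → V → ℝ} {u : ℝ × V → ℝ} {p : ℝ × V → V}
    {S : Set (ℝ × V)} (hS : IsOpen S) (hH : ContDiff ℝ 1 fun q : V × V => H q.1 q.2)
    (hp : ContDiffOn ℝ 1 p S)
    (hu : ∀ q ∈ S, HasFDerivAt u ((innerSL ℝ (p q)).comp (ContinuousLinearMap.snd ℝ ℝ V) -
        H q.2 (p q) • ContinuousLinearMap.fst ℝ ℝ V) q) : ContDiffOn ℝ 2 u S := by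
  refine (contDiffOn_succ_iff_hasFDerivWithinAt_of_uniqueDiffOn (n := 1)
    hS.uniqueDiffOn).2 ⟨by simp, _, ?_, fun q hq => (hu q hq).hasFDerivWithinAt⟩
  have hHp : ContDiffOn ℝ 1 (fun q : ℝ × V => H q.2 (p q)) S :=
    hH.comp_contDiffOn (contDiffOn_snd.prodMk hp)
  exact (((innerSL ℝ).contDiff.comp_contDiffOn hp).clm_comp contDiffOn_const).sub
    (hHp.smul contDiffOn_const)

end Action

section Uniqueness

lemma eq_zero_of_norm_derivWithin_le {E : Type*} [NormedAddCommGroup E] [NormedSpace ℝ E]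
    {f f' : ℝ → E} {T K t : ℝ} (hf : ∀ s ∈ Ico 0 T, HasDerivWithinAt f (f' s) (Ico 0 T) s)
    (h0 : f 0 = 0) (ht : t ∈ Ico 0 T) (bound : ∀ s ∈ Icc 0 t, ‖f' s‖ ≤ K * ‖f s‖) : f t = 0 := by
  have hsub : Icc 0 t ⊆ Ico 0 T := fun s hs => ⟨hs.1, hs.2.trans_lt ht.2⟩
  refine eq_zero_of_abs_deriv_le_mul_abs_self_of_eq_zero_right (f' := f') (K := K)
    (fun s hs => ((hf s (hsub hs)).continuousWithinAt).mono hsub) (fun s hs => ?_) h0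
    (fun s hs => bound s (Ico_subset_Icc_self hs)) t ⟨ht.1, le_rfl⟩
  refine (hf s (hsub (Ico_subset_Icc_self hs))).mono_of_mem_nhdsWithin ?_
  exact mem_of_superset (Ico_mem_nhdsGE (hs.2.trans ht.2)) (Ico_subset_Ico_left hs.1)

variable {V : Type*} [NormedAddCommGroup V] [NormedSpace ℝ V]

lemma uniqueDiffOn_strip {T : ℝ} :
    UniqueDiffOn ℝ (Ico 0 T ×ˢ (univ : Set V)) :=
  (uniqueDiffOn_Ico 0 T).prod uniqueDiffOn_univ

omit [NormedSpace ℝ V] in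
lemma subset_closure_interior_strip {T : ℝ} (hT : 0 < T) :
    Ico 0 T ×ˢ (univ : Set V) ⊆ closure (interior (Ico 0 T ×ˢ (univ : Set V))) := by
  rw [interior_prod_eq, interior_univ, interior_Ico, closure_prod_eq, closure_univ,
    closure_Ioo hT.ne]
  exact prod_mono Ico_subset_Icc_self subset_rfl

lemma HasFDerivWithinAt.hasFDerivAt_strip {E : Type*} [NormedAddCommGroup E] [NormedSpace ℝ E]
    {f : ℝ × V → E} {D : ℝ × V →L[ℝ] E} {s : Set ℝ} {t : ℝ} {x : V}
    (h : HasFDerivWithinAt f D (s ×ˢ univ) (t, x)) (ht : t ∈ s) :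
    HasFDerivAt (fun y => f (t, y)) (D.comp (ContinuousLinearMap.inr ℝ ℝ V)) x :=
  HasFDerivWithinAt.comp_hasFDerivAt (f := fun y : V => (t, y)) x h
    (hasFDerivAt_prodMk_right t x) (Eventually.of_forall fun _ => ⟨ht, mem_univ _⟩)

lemma HasFDerivWithinAt.hasDerivWithinAt_strip {E : Type*} [NormedAddCommGroup E]
    [NormedSpace ℝ E] {f : ℝ × V → E} {D : ℝ × V →L[ℝ] E} {s : Set ℝ} {t : ℝ} {c : ℝ → V} {c' : V}
    (h : HasFDerivWithinAt f D (s ×ˢ univ) (t, c t)) (hc : HasDerivWithinAt c c' s t) :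
    HasDerivWithinAt (fun τ => f (τ, c τ)) (D (1, c')) s t :=
  HasFDerivWithinAt.comp_hasDerivWithinAt (f := fun τ => (τ, c τ)) t h
    ((hasDerivWithinAt_id t s).prodMk hc) (fun _ hτ => ⟨hτ, mem_univ _⟩)

end Uniqueness

section HamiltonJacobi

set_option maxSynthPendingDepth 3

variable {V : Type*} [NormedAddCommGroup V] [InnerProductSpace ℝ V] [CompleteSpace V]

variable (V) in
/-- The spatial gradient encoded in a space-time differential. -/
def spatialGradient : (ℝ × V →L[ℝ] ℝ) →L[ℝ] V :=
  (rieszInv V).comp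
    ((ContinuousLinearMap.compL ℝ V (ℝ × V) ℝ).flip (ContinuousLinearMap.inr ℝ ℝ V))

lemma inner_spatialGradient (l : ℝ × V →L[ℝ] ℝ) (ξ : V) : ⟪spatialGradient V l, ξ⟫ = l (0, ξ) :=
  inner_rieszInv _ _

lemma gradient_eq_spatialGradient {f : V → ℝ} {l : ℝ × V →L[ℝ] ℝ} {x : V}
    (h : HasFDerivAt f (l.comp (ContinuousLinearMap.inr ℝ ℝ V)) x) :
    gradient f x = spatialGradient V l :=
  gradient_eq_rieszInv h

variable {H : V → V → ℝ} {T : ℝ} {f : ℝ × V → ℝ}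

/-- The Hamilton–Jacobi equation in terms of the space-time differential. -/
lemma fderivWithin_apply_one_zero (hf : DifferentiableOn ℝ f (Ico 0 T ×ˢ univ))
    (hpde : ∀ t ∈ Ico 0 T, ∀ x, HasDerivWithinAt (fun τ => f (τ, x))
      (-H x (gradient (fun y => f (t, y)) x)) (Ico 0 T) t) {t : ℝ} (ht : t ∈ Ico 0 T) (x : V) :
    fderivWithin ℝ f (Ico 0 T ×ˢ univ) (t, x) (1, 0) =
      -H x (spatialGradient V (fderivWithin ℝ f (Ico 0 T ×ˢ univ) (t, x))) := by
  have h := (hf (t, x) ⟨ht, mem_univ _⟩).hasFDerivWithinAt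
  rw [← gradient_eq_spatialGradient (h.hasFDerivAt_strip ht)]
  exact (uniqueDiffOn_Ico 0 T t ht).eq_deriv _
    (h.hasDerivWithinAt_strip (c := fun _ => x) (hasDerivWithinAt_const t _ x)) (hpde t ht x)

/-- The equation satisfied by the spatial gradient of a `C²` solution along a curve which moves
with velocity `H_p(x, p)`. -/
lemma hasDerivWithinAt_spatialGradient (hT : 0 < T)
    (hH : Differentiable ℝ fun q : V × V => H q.1 q.2)
    (hf : ContDiffOn ℝ 2 f (Ico 0 T ×ˢ univ))
    (hpde : ∀ t ∈ Ico 0 T, ∀ x, HasDerivWithinAt (fun τ => f (τ, x))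
      (-H x (gradient (fun y => f (t, y)) x)) (Ico 0 T) t) {t : ℝ} (ht : t ∈ Ico 0 T)
    {c : ℝ → V} {c' : V} (hc : HasDerivWithinAt c c' (Ico 0 T) t) {m : V}
    (hm : m = spatialGradient V (fderivWithin ℝ f (Ico 0 T ×ˢ univ) (t, c t))) :
    HasDerivWithinAt
      (fun τ => spatialGradient V (fderivWithin ℝ f (Ico 0 T ×ˢ univ) (τ, c τ)))
      (-gradient (fun x => H x m) (c t) +
        spatialGradient V (fderivWithin ℝ (fderivWithin ℝ f (Ico 0 T ×ˢ univ))
          (Ico 0 T ×ˢ univ) (t, c t) (0, c' - gradient (fun p => H (c t) p) m)))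
      (Ico 0 T) t := by
  set S := Ico 0 T ×ˢ (univ : Set V)
  set G := fderivWithin ℝ f S
  set D := fderivWithin ℝ G S (t, c t)
  have hq : (t, c t) ∈ S := ⟨ht, mem_univ _⟩
  have hS : UniqueDiffOn ℝ S := uniqueDiffOn_strip
  have hG : ContDiffOn ℝ 1 G S := hf.fderivWithin hS (by norm_num)
  have hD : HasFDerivWithinAt G D S (t, c t) :=
    (hG.differentiableOn one_ne_zero _ hq).hasFDerivWithinAt
  have hsymm : ∀ a b, D a b = D b a :=
    (hf (t, c t) hq).isSymmSndFDerivWithinAt (by simp) hS (subset_closure_interior_strip hT hq) hq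
  have hDx : ∀ ξ, D (0, ξ) (1, 0) = -(⟪gradient (fun x => H x m) (c t), ξ⟫ +
      ⟪gradient (fun p => H (c t) p) m, spatialGradient V (D (0, ξ))⟫) := by
    intro ξ
    have h1 := hD.hasFDerivAt_strip ht
    have h2 := h1.clm_apply (hasFDerivAt_const ((1 : ℝ), (0 : V)) (c t))
    have h3 : HasFDerivAt (fun y => (y, spatialGradient V (G (t, y)))) _ (c t) :=
      (hasFDerivAt_id (c t)).prodMk ((spatialGradient V).hasFDerivAt.comp (c t) h1)
    have h4 := (HasFDerivAt.comp (g := fun q : V × V => H q.1 q.2) (c t) (hH _).hasFDerivAt h3).neg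
    have h5 : (fun y => G (t, y) (1, 0)) = fun y => -H y (spatialGradient V (G (t, y))) :=
      funext fun y => fderivWithin_apply_one_zero (hf.differentiableOn two_ne_zero) hpde ht y
    have h6 := (h5 ▸ h2 : HasFDerivAt (fun y => -H y (spatialGradient V (G (t, y)))) _ (c t))
    have h7 := congrArg (fun l : V →L[ℝ] ℝ => l ξ) (h6.unique h4)
    simpa [fderiv_hamiltonian_apply (hH _), hm] using h7
  have h := ((spatialGradient V).hasFDerivAt (x := G (t, c t))).comp_hasDerivWithinAt t
    (hD.hasDerivWithinAt_strip hc)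
  refine h.congr_deriv (ext_inner_right ℝ fun ξ => ?_)
  have e1 : ((1 : ℝ), c') = (1, 0) + (0, c') := by simp
  have e2 : ((0 : ℝ), c' - gradient (fun p => H (c t) p) m) =
    (0, c') - (0, gradient (fun p => H (c t) p) m) := by simp
  rw [inner_spatialGradient, hsymm, e1, map_add, hDx, inner_add_left, inner_spatialGradient,
    hsymm (0, _) (0, ξ), e2, map_sub, inner_neg_left,
    real_inner_comm (spatialGradient V _), inner_spatialGradient]
  ring

/-- A `C²` solution of the Hamilton–Jacobi equation is determined along the characteristics. -/
theorem eq_action_of_contDiffOn {L : ℝ} {u₀ : V → ℝ} (hT : 0 < T)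
    (hH : Differentiable ℝ fun q : V × V => H q.1 q.2)
    (hL : ∀ a b, ‖hamiltonianField H a - hamiltonianField H b‖ ≤ L * ‖a - b‖)
    {X P : ℝ → V} {W : ℝ → ℝ}
    (hP0 : P 0 = gradient u₀ (X 0)) (hW0 : W 0 = u₀ (X 0))
    (hX : ∀ t, HasDerivAt X (gradient (fun p => H (X t) p) (P t)) t)
    (hP : ∀ t, HasDerivAt P (-gradient (fun x => H x (P t)) (X t)) t)
    (hW : ∀ t, HasDerivAt W
      (-(H (X t) (P t)) + ⟪P t, gradient (fun p => H (X t) p) (P t)⟫) t)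
    (hf : ContDiffOn ℝ 2 f (Ico 0 T ×ˢ univ))
    (hpde : ∀ t ∈ Ico 0 T, ∀ x, HasDerivWithinAt (fun τ => f (τ, x))
      (-H x (gradient (fun y => f (t, y)) x)) (Ico 0 T) t)
    (hf0 : ∀ x, f (0, x) = u₀ x) {t : ℝ} (ht : t ∈ Ico 0 T) : f (t, X t) = W t := by
  set S := Ico 0 T ×ˢ (univ : Set V)
  set G := fderivWithin ℝ f S
  have h0 : (0 : ℝ) ∈ Ico 0 T := ⟨le_rfl, hT⟩
  have hS : UniqueDiffOn ℝ S := uniqueDiffOn_strip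
  have hG : ContDiffOn ℝ 1 G S := hf.fderivWithin hS (by norm_num)
  have hfd : ∀ s ∈ Ico 0 T, ∀ x, HasFDerivWithinAt f (G (s, x)) S (s, x) := fun s hs x =>
    (hf.differentiableOn two_ne_zero (s, x) ⟨hs, mem_univ _⟩).hasFDerivWithinAt
  have hr : ∀ t ∈ Ico 0 T, spatialGradient V (G (t, X t)) - P t = 0 := by
    intro t ht
    have hcont : ContinuousOn (fun s => ‖fderivWithin ℝ G S (s, X s)‖) (Icc 0 t) := by
      refine ((hG.continuousOn_fderivWithin hS le_rfl).comp (t := S)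
        (f := fun s => (s, X s)) ?_ fun s hs => ⟨⟨hs.1, hs.2.trans_lt ht.2⟩, mem_univ _⟩).norm
      exact (continuous_id.prodMk
        (continuous_iff_continuousAt.2 fun s => (hX s).continuousAt)).continuousOn
    obtain ⟨B, hB⟩ := isCompact_Icc.bddAbove_image hcont
    have hB0 : ∀ s ∈ Icc 0 t, ‖fderivWithin ℝ G S (s, X s)‖ ≤ B := fun s hs =>
      hB (mem_image_of_mem _ hs)
    refine eq_zero_of_norm_derivWithin_le (K := L + ‖spatialGradient V‖ * (B * L))
      (f := fun t => spatialGradient V (G (t, X t)) - P t)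
      (fun s hs => (hasDerivWithinAt_spatialGradient hT hH hf hpde hs
        (hX s).hasDerivWithinAt rfl).sub (hP s).hasDerivWithinAt) ?_ ht fun s hs => ?_
    · rw [hP0, ← funext hf0, gradient_eq_spatialGradient ((hfd 0 h0 (X 0)).hasFDerivAt_strip h0),
        sub_self]
    · set m := spatialGradient V (G (s, X s))
      have h1 := hL (X s, P s) (X s, m)
      have h2 : ‖((X s, P s) : V × V) - (X s, m)‖ = ‖m - P s‖ := by
        simp [Prod.norm_def, norm_sub_rev]
      rw [h2] at h1
      have h3 : ‖gradient (fun p => H (X s) p) (P s) - gradient (fun p => H (X s) p) m‖ ≤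
        L * ‖m - P s‖ := (norm_fst_le _).trans h1
      have h4 : ‖-gradient (fun x => H x (P s)) (X s) - -gradient (fun x => H x m) (X s)‖ ≤
        L * ‖m - P s‖ := (norm_snd_le _).trans h1
      set d := gradient (fun p => H (X s) p) (P s) - gradient (fun p => H (X s) p) m
      have h5 : ‖((0 : ℝ), d)‖ = ‖d‖ := by simp [Prod.norm_def]
      have h6 : ‖spatialGradient V (fderivWithin ℝ G S (s, X s) (0, d))‖ ≤
          ‖spatialGradient V‖ * (B * (L * ‖m - P s‖)) := by
        refine (ContinuousLinearMap.le_opNorm _ _).trans ?_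
        gcongr
        refine (ContinuousLinearMap.le_opNorm _ _).trans ?_
        rw [h5]
        have := hB0 s hs
        have := (norm_nonneg _).trans this
        gcongr
      rw [add_sub_right_comm]
      rw [norm_sub_rev] at h4
      exact (norm_add_le _ _).trans ((add_le_add h4 h6).trans_eq (by ring))
  have h : f (t, X t) - W t = 0 := by
    refine eq_zero_of_norm_derivWithin_le (K := 0) (f := fun t => f (t, X t) - W t)
      (fun s hs => ((hfd s hs (X s)).hasDerivWithinAt_strip (hX s).hasDerivWithinAt).sub
        (hW s).hasDerivWithinAt) (by simp [hf0, hW0]) ht fun s hs => ?_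
    have hs' : s ∈ Ico 0 T := ⟨hs.1, hs.2.trans_lt ht.2⟩
    rw [zero_mul, norm_le_zero_iff]
    have e1 (c' : V) : ((1 : ℝ), c') = (1, 0) + (0, c') := by simp
    rw [e1, map_add, fderivWithin_apply_one_zero (hf.differentiableOn two_ne_zero) hpde hs',
      ← inner_spatialGradient, sub_eq_zero.1 (hr s hs')]
    exact sub_self _
  exact sub_eq_zero.1 h

end HamiltonJacobi

section Characteristics

variable {V : Type*} [NormedAddCommGroup V] [InnerProductSpace ℝ V] [CompleteSpace V]

lemma exists_norm_prodMk_gradient_sub_le {u₀ : V → ℝ} {C₀ : ℝ} (hu₀ : ContDiff ℝ 2 u₀)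
    (hC₀ : ∀ z, ‖iteratedFDeriv ℝ 2 u₀ z‖ ≤ C₀) :
    ∃ M, 0 < M ∧ ∀ z z', ‖((z', gradient u₀ z') : V × V) - (z, gradient u₀ z)‖ ≤
      M * ‖z' - z‖ := by
  have hd := (hu₀.fderiv_right (m := 1) (by norm_num)).differentiable one_ne_zero
  obtain ⟨K, hK0, hK⟩ := exists_norm_fderiv_clm_comp_le (rieszInv V) hd
    (norm_fderiv_fderiv_le hC₀)
  have h1 := norm_image_sub_le_of_norm_fderiv_le' ((rieszInv V).differentiable.comp hd) hK
  refine ⟨K + 1, by positivity, fun z z' => ?_⟩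
  rw [Prod.mk_sub_mk, Prod.norm_def]
  have h2 : ‖gradient u₀ z' - gradient u₀ z‖ ≤ K * ‖z' - z‖ := h1 z' z
  have h3 := norm_nonneg (z' - z)
  refine max_le ?_ ?_ <;> nlinarith

lemma exists_pos_time {L M : ℝ} (hL0 : 0 < L) (hM0 : 0 < M) :
    ∃ T > 0, 2 * L * T ≤ 1 ∧ L * (M * Real.exp (L * T)) * T ≤ 1 / 2 := by
  refine ⟨min (1 / (2 * L)) (1 / (2 * (L * (M * Real.exp (1 / 2))))), by positivity, ?_, ?_⟩
  · calc _ ≤ 2 * L * (1 / (2 * L)) := by gcongr; exact min_le_left _ _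
      _ = 1 := by field_simp
  · set T := min (1 / (2 * L)) (1 / (2 * (L * (M * Real.exp (1 / 2)))))
    have h1 : L * T ≤ 1 / 2 := by
      calc _ ≤ L * (1 / (2 * L)) := by gcongr; exact min_le_left _ _
        _ = 1 / 2 := by field_simp
    calc _ ≤ L * (M * Real.exp (1 / 2)) * (1 / (2 * (L * (M * Real.exp (1 / 2))))) := by
          gcongr
          exact min_le_right _ _
      _ = 1 / 2 := by field_simp

/-- For short times the position map is a contractive perturbation of the identity. -/
lemma norm_position_sub_sub_le {H : V → V → ℝ} {L K T : ℝ} (hL0 : 0 < L) (hK0 : 0 ≤ K)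
    (hL : ∀ a b, ‖hamiltonianField H a - hamiltonianField H b‖ ≤ L * ‖a - b‖)
    (hLKT : L * K * T ≤ 1 / 2) {X P : ℝ → V → V} (hX0 : ∀ z, X 0 z = z)
    (hX : ∀ t z, HasDerivAt (fun τ => X τ z) (gradient (fun p => H (X t z) p) (P t z)) t)
    (hflow : ∀ t ∈ Ioo (-T) T, ∀ z z',
      ‖((X t z', P t z') : V × V) - (X t z, P t z)‖ ≤ K * ‖z' - z‖) :
    ∀ t ∈ Ioo (-T) T, ∀ z z', ‖X t z - X t z' - (z - z')‖ ≤ 1 / 2 * ‖z - z'‖ := by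
  intro t ht z z'
  have h := norm_le_of_norm_deriv_le (f := fun t => X t z - X t z' - (z - z')) (K := 0) (δ := 0)
    (ε := L * K * ‖z - z'‖) (T := T) le_rfl (by positivity)
    (fun t _ => ((hX t z).sub (hX t z')).sub_const _) (by simp [hX0]) (fun s hs => ?_) t ht
  · rw [zero_mul, Real.exp_zero, mul_one, zero_add] at h
    refine h.trans ?_
    rw [mul_right_comm]
    gcongr
  · rw [zero_mul, zero_add]
    refine (norm_fst_le (hamiltonianField H (X s z, P s z) -
      hamiltonianField H (X s z', P s z'))).trans ((hL _ _).trans ?_)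
    rw [mul_assoc]
    gcongr
    exact hflow s hs z' z

/-- Local solution by characteristics, on a real Hilbert space. -/
theorem exists_characteristics_solution {H : V → V → ℝ} {u₀ : V → ℝ}
    (hH : ContDiff ℝ 2 fun q : V × V => H q.1 q.2)
    (hH2 : ∃ C : ℝ, ∀ q : V × V, ‖iteratedFDeriv ℝ 2 (fun q : V × V => H q.1 q.2) q‖ ≤ C)
    (hu₀ : ContDiff ℝ 2 u₀) (hu₀2 : ∃ C : ℝ, ∀ z, ‖iteratedFDeriv ℝ 2 u₀ z‖ ≤ C)
    {X P : ℝ → V → V} {W : ℝ → V → ℝ}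
    (hX0 : ∀ z, X 0 z = z)
    (hP0 : ∀ z, P 0 z = gradient u₀ z)
    (hW0 : ∀ z, W 0 z = u₀ z)
    (hX : ∀ t z, HasDerivAt (fun τ => X τ z)
      (gradient (fun p => H (X t z) p) (P t z)) t)
    (hP : ∀ t z, HasDerivAt (fun τ => P τ z)
      (-gradient (fun x => H x (P t z)) (X t z)) t)
    (hW : ∀ t z, HasDerivAt (fun τ => W τ z)
      (-(H (X t z) (P t z)) +
        ⟪P t z, gradient (fun p => H (X t z) p) (P t z)⟫) t) :
    ∃ Tstar > (0:ℝ), ∃ Z : ℝ → V → V,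
      (∀ t ∈ Ico (0:ℝ) Tstar, Bijective (X t) ∧ ContDiff ℝ 1 (Z t) ∧
        LeftInverse (Z t) (X t) ∧ RightInverse (Z t) (X t)) ∧
      ContDiffOn ℝ 2 (fun q : ℝ × V => W q.1 (Z q.1 q.2))
        (Ico (0:ℝ) Tstar ×ˢ univ) ∧
      (∀ x, W 0 (Z 0 x) = u₀ x) ∧
      (∀ t ∈ Ico (0:ℝ) Tstar, ∀ x, HasDerivWithinAt (fun τ => W τ (Z τ x))
        (-H x (gradient (fun y => W t (Z t y)) x)) (Ico (0:ℝ) Tstar) t) ∧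
      (∀ v : ℝ → V → ℝ,
        ContDiffOn ℝ 2 (fun q : ℝ × V => v q.1 q.2)
          (Ico (0:ℝ) Tstar ×ˢ univ) →
        (∀ t ∈ Ico (0:ℝ) Tstar, ∀ x, HasDerivWithinAt (fun τ => v τ x)
          (-H x (gradient (v t) x)) (Ico (0:ℝ) Tstar) t) →
        (∀ x, v 0 x = u₀ x) →
        ∀ t ∈ Ico (0:ℝ) Tstar, ∀ x, v t x = W t (Z t x)) := by
  obtain ⟨C, hC⟩ := hH2
  obtain ⟨C₀, hC₀⟩ := hu₀2
  obtain ⟨L, hL0, hFL⟩ := exists_norm_fderiv_hamiltonianField_le hH hC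
  have hF := contDiff_hamiltonianField hH
  have hL := norm_image_sub_le_of_norm_fderiv_le' (hF.differentiable one_ne_zero) hFL
  obtain ⟨M, hM0, hM⟩ := exists_norm_prodMk_gradient_sub_le hu₀ hC₀
  have hMT : ∀ z z', ‖((X 0 z', P 0 z') : V × V) - (X 0 z, P 0 z)‖ ≤ M * ‖z' - z‖ := by
    simpa only [hX0, hP0] using hM
  have hΦ0 : ContDiff ℝ 1 fun z => ((X 0 z, P 0 z) : V × V) := by
    simp only [hX0, hP0]
    exact contDiff_id.prodMk
      ((rieszInv V).contDiff.comp (hu₀.fderiv_right (m := 1) (by norm_num)))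
  have hΦ : ∀ t z, HasDerivAt (fun τ => ((X τ z, P τ z) : V × V))
      (hamiltonianField H (X t z, P t z)) t := fun t z => (hX t z).prodMk (hP t z)
  obtain ⟨T, hT, hLT, hMLT⟩ := exists_pos_time hL0 hM0
  have hflow : ∀ t ∈ Ioo (-T) T, ∀ z z', ‖((X t z', P t z') : V × V) - (X t z, P t z)‖ ≤
      M * Real.exp (L * T) * ‖z' - z‖ := fun t ht z z' =>
    calc _ ≤ ‖((X 0 z', P 0 z') : V × V) - (X 0 z, P 0 z)‖ * Real.exp (L * T) :=
          norm_flow_sub_le hL0.le hL hΦ z z' t ht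
      _ ≤ M * ‖z' - z‖ * Real.exp (L * T) := by gcongr; exact hMT z z'
      _ = _ := by ring
  have hΦC := contDiffOn_flow hF hFL hT hLT hΦ0 hM0 hMT hΦ
  have hXC : ContDiffOn ℝ 1 (uncurry X) (Ioo (-T) T ×ˢ univ) := hΦC.fst
  have hPC : ContDiffOn ℝ 1 (uncurry P) (Ioo (-T) T ×ˢ univ) := hΦC.snd
  have hlip := norm_position_sub_sub_le hL0 (by positivity) hL hMLT hX0 hX hflow
  obtain ⟨Q, hQ0, hQ⟩ := exists_abs_action_sub_le hH hC hL0.le hL hu₀ hC₀ hT hX0 hP0 hW0 hX hP hW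
    hflow
  obtain ⟨Z, hZ, hZC⟩ := exists_contDiffOn_inverse isOpen_Ioo hXC hlip
  have hsub : Ico 0 T ⊆ Ioo (-T) T := fun t ht => ⟨by linarith [ht.1], ht.2⟩
  have h0 : (0 : ℝ) ∈ Ico 0 T := ⟨le_rfl, hT⟩
  have hu := fun t (ht : t ∈ Ioo (-T) T) x => hasFDerivAt_action isOpen_Ioo hX hP hW hlip
    (fun t ht => (hZ t ht).2) hQ0 hQ ht x
  have hPZ : ContDiffOn ℝ 1 (fun q : ℝ × V => P q.1 (Z q.1 q.2)) (Ioo (-T) T ×ˢ univ) :=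
    hPC.comp (contDiffOn_fst.prodMk hZC) fun q hq => ⟨hq.1, mem_univ _⟩
  have hgrad : ∀ t ∈ Ioo (-T) T, ∀ x, gradient (fun y => W t (Z t y)) x = P t (Z t x) := by
    intro t ht x
    refine gradient_eq_of_hasFDerivAt_innerSL
      (((hu t ht x).hasFDerivWithinAt.hasFDerivAt_strip ht).congr_fderiv ?_)
    ext ξ
    simp
  refine ⟨T, hT, Z, fun t ht => ⟨⟨(hZ t (hsub ht)).1.injective, (hZ t (hsub ht)).2.surjective⟩,
    ?_, hZ t (hsub ht)⟩, ?_, fun x => ?_, fun t ht x => ?_, fun v hv hpde hv0 t ht x => ?_⟩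
  · exact contDiffOn_univ.1 (hZC.comp (f := fun x => (t, x))
      (contDiff_const.prodMk contDiff_id).contDiffOn fun x _ => ⟨hsub ht, mem_univ _⟩)
  · exact (contDiffOn_two_of_hasFDerivAt (isOpen_Ioo.prod isOpen_univ)
      (hH.of_le one_le_two) hPZ fun q hq => hu q.1 hq.1 q.2).mono (prod_mono hsub subset_rfl)
  · have h := (hZ 0 (hsub h0)).2 x
    rw [hX0] at h
    rw [h, hW0]
  · rw [hgrad t (hsub ht) x]
    have h := (hu t (hsub ht) x).hasFDerivWithinAt (s := Ico 0 T ×ˢ univ) |>.hasDerivWithinAt_strip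
      (c := fun _ => x) (hasDerivWithinAt_const t _ x)
    simpa using h
  · have h := eq_action_of_contDiffOn hT (hH.differentiable two_ne_zero) hL
      (X := fun τ => X τ (Z t x)) (P := fun τ => P τ (Z t x)) (W := fun τ => W τ (Z t x))
      (by simp only [hP0, hX0]) (by simp only [hW0, hX0]) (fun τ => hX τ (Z t x))
      (fun τ => hP τ (Z t x)) (fun τ => hW τ (Z t x)) hv hpde hv0 ht
    simpa only [(hZ t (hsub ht)).2 x] using h

end Characteristics

end Auxiliary

/-- Local classical solution of the Cauchy problem for the Hamilton–Jacobi
equation by the method of characteristics. -/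
theorem method_of_characteristics {n : ℕ}
    (H : En n → En n → ℝ) (u₀ : En n → ℝ)
    (hH : ContDiff ℝ 2 fun q : En n × En n => H q.1 q.2)
    (hH2 : ∃ C : ℝ, ∀ q : En n × En n,
      ‖iteratedFDeriv ℝ 2 (fun q : En n × En n => H q.1 q.2) q‖ ≤ C)
    (hu₀ : ContDiff ℝ 2 u₀)
    (hu₀1 : ∃ C : ℝ, ∀ z, ‖gradient u₀ z‖ ≤ C)
    (hu₀2 : ∃ C : ℝ, ∀ z, ‖iteratedFDeriv ℝ 2 u₀ z‖ ≤ C)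
    (X P : ℝ → En n → En n) (W : ℝ → En n → ℝ)
    (hX0 : ∀ z, X 0 z = z)
    (hP0 : ∀ z, P 0 z = gradient u₀ z)
    (hW0 : ∀ z, W 0 z = u₀ z)
    (hX : ∀ t z, HasDerivAt (fun τ => X τ z)
      (gradient (fun p => H (X t z) p) (P t z)) t)
    (hP : ∀ t z, HasDerivAt (fun τ => P τ z)
      (-gradient (fun x => H x (P t z)) (X t z)) t)
    (hW : ∀ t z, HasDerivAt (fun τ => W τ z)
      (-(H (X t z) (P t z)) +
        ⟪P t z, gradient (fun p => H (X t z) p) (P t z)⟫) t) :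
    ∃ Tstar > (0:ℝ), ∃ Z : ℝ → En n → En n,
      (∀ t ∈ Ico (0:ℝ) Tstar, Bijective (X t) ∧ ContDiff ℝ 1 (Z t) ∧
        LeftInverse (Z t) (X t) ∧ RightInverse (Z t) (X t)) ∧
      -- `u(t,x) := W(t, Z(t,x))` is of class `C²` on `[0,T*) × ℝⁿ`
      ContDiffOn ℝ 2 (fun q : ℝ × En n => W q.1 (Z q.1 q.2))
        (Ico (0:ℝ) Tstar ×ˢ univ) ∧
      -- it satisfies the initial condition
      (∀ x, W 0 (Z 0 x) = u₀ x) ∧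
      -- it solves `∂u/∂t + H(x, ∇u(t,x)) = 0` on `[0,T*) × ℝⁿ`
      (∀ t ∈ Ico (0:ℝ) Tstar, ∀ x, HasDerivWithinAt (fun τ => W τ (Z τ x))
        (-H x (gradient (fun y => W t (Z t y)) x)) (Ico (0:ℝ) Tstar) t) ∧
      -- and it is the unique `C²` solution of the Cauchy problem there
      (∀ v : ℝ → En n → ℝ,
        ContDiffOn ℝ 2 (fun q : ℝ × En n => v q.1 q.2)
          (Ico (0:ℝ) Tstar ×ˢ univ) →
        (∀ t ∈ Ico (0:ℝ) Tstar, ∀ x, HasDerivWithinAt (fun τ => v τ x)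
          (-H x (gradient (v t) x)) (Ico (0:ℝ) Tstar) t) →
        (∀ x, v 0 x = u₀ x) →
        ∀ t ∈ Ico (0:ℝ) Tstar, ∀ x, v t x = W t (Z t x)) :=
  exists_characteristics_solution hH hH2 hu₀ hu₀2 hX0 hP0 hW0 hX hP hW
end
end

section
/- (Kantorovich duality) Let M be a compact metric space, c : M × M → ℝ a continuous cost function, and μ₀, μ₁ Borel probability measures on M. Then C(μ₀,μ₁) := min over transport plans γ of ∫_{M×M} c dγ equals the maximum, over all admissible Kantorovich pairs (φ₀,φ₁), of ∫_M φ₁ dμ₁ − ∫_M φ₀ dμ₀; moreover both the minimum over transport plans and the maximum over admissible Kantorovich pairs are attained. -/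
open MeasureTheory Set

noncomputable section

/-- A transport plan between `μ₀` and `μ₁`: a Borel probability measure on
`M × M` whose marginals are `μ₀` and `μ₁`. -/
def IsPlan {M : Type*} [MeasurableSpace M] (μ₀ μ₁ : Measure M)
    (γ : Measure (M × M)) : Prop :=
  IsProbabilityMeasure γ ∧ γ.map Prod.fst = μ₀ ∧ γ.map Prod.snd = μ₁

/-- An admissible Kantorovich pair for the cost `c`:
`φ₁ y = min_x (φ₀ x + c x y)` and `φ₀ x = max_y (φ₁ y - c x y)`,
the min and max being attained. -/
def IsAdmPair {M : Type*} (c : M → M → ℝ) (φ₀ φ₁ : M → ℝ)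
    [TopologicalSpace M] : Prop :=
  Continuous φ₀ ∧ Continuous φ₁ ∧
    (∀ y, IsLeast { r | ∃ x, r = φ₀ x + c x y } (φ₁ y)) ∧
    (∀ x, IsGreatest { r | ∃ y, r = φ₁ y - c x y } (φ₀ x))

open Filter Topology CompactlySupported

section InfTransform

variable {X Y : Type*} [TopologicalSpace X] [CompactSpace X] [Nonempty X]
  [TopologicalSpace Y]

theorem ContinuousMap.isLeast_iInf (f : C(X, ℝ)) : IsLeast (range f) (⨅ x, f x) :=
  (isCompact_range f.continuous).isLeast_sInf (range_nonempty f)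

theorem ContinuousMap.iInf_le_apply (f : C(X, ℝ)) (x : X) : ⨅ x, f x ≤ f x :=
  f.isLeast_iInf.2 ⟨x, rfl⟩

theorem ContinuousMap.lipschitzWith_iInf : LipschitzWith 1 fun f : C(X, ℝ) => ⨅ x, f x := by
  refine LipschitzWith.of_le_add fun f g => ?_
  obtain ⟨x, hx⟩ := g.isLeast_iInf.1
  have h := (abs_le.1 (ContinuousMap.dist_apply_le_dist (f := f) (g := g) x)).2
  linarith [f.iInf_le_apply x]

/-- The infimal transform `y ↦ min_x (f x + k y x)` of a continuous function. -/
def infTransform (k : C(Y, C(X, ℝ))) (f : C(X, ℝ)) : C(Y, ℝ) where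
  toFun y := ⨅ x, (f + k y) x
  continuous_toFun := ContinuousMap.lipschitzWith_iInf.continuous.comp (by fun_prop)

theorem infTransform_apply (k : C(Y, C(X, ℝ))) (f : C(X, ℝ)) (y : Y) :
    infTransform k f y = ⨅ x, (f + k y) x :=
  rfl

theorem infTransform_le (k : C(Y, C(X, ℝ))) (f : C(X, ℝ)) (x : X) (y : Y) :
    infTransform k f y ≤ f x + k y x :=
  (f + k y).iInf_le_apply x

theorem exists_infTransform_eq (k : C(Y, C(X, ℝ))) (f : C(X, ℝ)) (y : Y) :
    ∃ x, infTransform k f y = f x + k y x := by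
  obtain ⟨x, hx⟩ := (f + k y).isLeast_iInf.1
  exact ⟨x, hx.symm⟩

theorem le_infTransform_iff {k : C(Y, C(X, ℝ))} {f : C(X, ℝ)} {y : Y} {r : ℝ} :
    r ≤ infTransform k f y ↔ ∀ x, r ≤ f x + k y x := by
  refine ⟨fun h x => h.trans (infTransform_le k f x y), fun h => ?_⟩
  obtain ⟨x, hx⟩ := exists_infTransform_eq k f y
  exact hx ▸ h x

theorem dist_infTransform_apply_le (k : C(Y, C(X, ℝ))) (f : C(X, ℝ)) (y y' : Y) :
    dist (infTransform k f y) (infTransform k f y') ≤ dist (k y) (k y') := by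
  simpa [infTransform_apply] using
    ContinuousMap.lipschitzWith_iInf.dist_le_mul (f + k y) (f + k y')

theorem continuous_infTransform [CompactSpace Y] [Nonempty Y] (k : C(Y, C(X, ℝ))) :
    Continuous (infTransform k) := by
  refine LipschitzWith.continuous (K := 1) (LipschitzWith.of_dist_le_mul fun f g => ?_)
  rw [ContinuousMap.dist_le_iff_of_nonempty]
  intro y
  simpa [infTransform_apply] using
    ContinuousMap.lipschitzWith_iInf.dist_le_mul (f + k y) (g + k y)

end InfTransform

/-- Continuous functions vanishing at a base point and having a prescribed modulus of continuity
form a compact set. -/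
theorem isCompact_setOf_dist_le {X E : Type*} [TopologicalSpace X] [PseudoMetricSpace E]
    (k : C(X, E)) (x₀ : X) :
    IsCompact {f : C(X, ℝ) | f x₀ = 0 ∧ ∀ x x', dist (f x) (f x') ≤ dist (k x) (k x')} := by
  have key (g : X → ℝ) (hg : ∀ x x', dist (g x) (g x') ≤ dist (k x) (k x')) : Continuous g := by
    refine continuous_iff_continuousAt.2 fun x => tendsto_iff_dist_tendsto_zero.2 ?_
    refine squeeze_zero (fun _ => dist_nonneg) (fun x' => hg x' x) ?_
    exact tendsto_iff_dist_tendsto_zero.1 (k.continuous.tendsto x)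
  refine ArzelaAscoli.isCompact_of_equicontinuous _ ?_ ?_
  · have himage : ContinuousMap.toFun ''
        {f : C(X, ℝ) | f x₀ = 0 ∧ ∀ x x', dist (f x) (f x') ≤ dist (k x) (k x')} =
        {g : X → ℝ | g x₀ = 0 ∧ ∀ x x', dist (g x) (g x') ≤ dist (k x) (k x')} := by
      ext g
      exact ⟨fun ⟨f, hf, hfg⟩ => hfg ▸ hf, fun hg => ⟨⟨g, key g hg.2⟩, hg, rfl⟩⟩
    rw [himage]
    refine (isCompact_univ_pi fun x =>
      isCompact_closedBall (0 : ℝ) (dist (k x) (k x₀))).of_isClosed_subset ?_ fun g hg x _ => ?_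
    · simp only [ofPred_and, ofPred_forall]
      refine (isClosed_eq (continuous_apply _) continuous_const).inter ?_
      exact isClosed_iInter fun x => isClosed_iInter fun x' =>
        isClosed_le ((continuous_apply x).dist (continuous_apply x')) continuous_const
    · simpa [hg.1] using hg.2 x x₀
  · intro x
    refine Metric.equicontinuousAt_iff_right.2 fun ε hε => ?_
    filter_upwards [Metric.tendsto_nhds.1 (k.continuous.tendsto x) ε hε] with x' hx' f
    exact (f.2.2 x x').trans_lt (by rwa [dist_comm])

theorem ContinuousMap.integrable_of_compactSpace {X : Type*} [TopologicalSpace X] [CompactSpace X]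
    [MeasurableSpace X] [OpensMeasurableSpace X] (f : C(X, ℝ)) (μ : Measure X)
    [IsFiniteMeasure μ] : Integrable f μ :=
  (BoundedContinuousFunction.mkOfCompact f).integrable μ

theorem ContinuousMap.continuous_integral {X : Type*} [TopologicalSpace X] [CompactSpace X]
    [MeasurableSpace X] [OpensMeasurableSpace X] (μ : Measure X) [IsProbabilityMeasure μ] :
    Continuous fun f : C(X, ℝ) => ∫ x, f x ∂μ := by
  refine LipschitzWith.continuous (K := 1) (LipschitzWith.of_dist_le_mul fun f g => ?_)
  rw [dist_eq_norm, ← integral_sub (f.integrable_of_compactSpace μ) (g.integrable_of_compactSpace μ)]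
  have h := norm_integral_le_of_norm_le_const (μ := μ) (f := fun x => f x - g x) (C := dist f g)
    (ae_of_all _ fun x => by
      rw [← dist_eq_norm]; exact ContinuousMap.dist_apply_le_dist x)
  simpa using h

/-- A sublinear functional is supported at every point by a dominated linear functional. -/
theorem exists_linearMap_eq_of_sublinear {E : Type*} [AddCommGroup E] [Module ℝ E] (N : E → ℝ)
    (N_hom : ∀ c : ℝ, 0 < c → ∀ x, N (c • x) = c * N x) (N_add : ∀ x y, N (x + y) ≤ N x + N y)
    (x : E) : ∃ g : E →ₗ[ℝ] ℝ, g x = N x ∧ ∀ y, g y ≤ N y := by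
  have N_zero : N 0 = 0 := by
    have h := N_hom 2 two_pos 0
    rw [smul_zero] at h
    linarith
  have hx (c : ℝ) (hc : c • x = 0) : c • N x = 0 := by
    rcases smul_eq_zero.1 hc with rfl | rfl
    · simp
    · simp [N_zero]
  obtain ⟨g, hg, hgN⟩ := exists_extension_of_le_sublinear
    (LinearPMap.mkSpanSingleton' (σ := RingHom.id ℝ) x (N x) hx) N N_hom N_add (by
      rintro ⟨y, hy⟩
      obtain ⟨c, rfl⟩ := Submodule.mem_span_singleton.1 hy
      rw [LinearPMap.mkSpanSingleton'_apply]
      simp only [RingHom.id_apply, smul_eq_mul]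
      rcases lt_trichotomy c 0 with hc | rfl | hc
      · have h := N_add (c • x) ((-c) • x)
        rw [N_hom (-c) (neg_pos.2 hc), neg_smul, add_neg_cancel, N_zero] at h
        linarith
      · simp [N_zero]
      · exact (N_hom c hc x).ge)
  refine ⟨g, ?_, hgN⟩
  exact (hg ⟨x, Submodule.mem_span_singleton_self x⟩).trans
    (LinearPMap.mkSpanSingleton'_apply_self _ _ _ _)

section Plans

variable {M : Type*} [MetricSpace M] [CompactSpace M] [MeasurableSpace M]

/-- The values of `∫ a dμ₀ + ∫ b dμ₁` over continuous `a`, `b` with `f x y ≤ a x + b y`. -/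
def majorantValues (μ₀ μ₁ : Measure M) (f : C(M × M, ℝ)) : Set ℝ :=
  {r | ∃ a b : C(M, ℝ), (∀ x y, f (x, y) ≤ a x + b y) ∧ r = ∫ x, a x ∂μ₀ + ∫ y, b y ∂μ₁}

theorem majorantValues_nonempty (μ₀ μ₁ : Measure M) (f : C(M × M, ℝ)) :
    (majorantValues μ₀ μ₁ f).Nonempty :=
  ⟨_, ContinuousMap.const M ‖f‖, 0, fun x y => by
    simpa using (le_abs_self _).trans (f.norm_coe_le_norm (x, y)), rfl⟩

variable [BorelSpace M] {μ₀ μ₁ : Measure M}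

theorem isPlan_prod (μ₀ μ₁ : Measure M) [IsProbabilityMeasure μ₀] [IsProbabilityMeasure μ₁] :
    IsPlan μ₀ μ₁ (μ₀.prod μ₁) :=
  ⟨inferInstance, Measure.map_fst_prod.trans (by simp), Measure.map_snd_prod.trans (by simp)⟩

theorem IsPlan.integral_le {γ : Measure (M × M)} (hγ : IsPlan μ₀ μ₁ γ) {f : C(M × M, ℝ)}
    {a b : C(M, ℝ)} (h : ∀ x y, f (x, y) ≤ a x + b y) :
    ∫ p, f p ∂γ ≤ ∫ x, a x ∂μ₀ + ∫ y, b y ∂μ₁ := by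
  obtain ⟨hγ, h₀, h₁⟩ := hγ
  have ha := (a.comp ContinuousMap.fst).integrable_of_compactSpace γ
  have hb := (b.comp ContinuousMap.snd).integrable_of_compactSpace γ
  rw [← h₀, ← h₁, integral_map measurable_fst.aemeasurable a.continuous.aestronglyMeasurable,
    integral_map measurable_snd.aemeasurable b.continuous.aestronglyMeasurable]
  exact (integral_mono (f.integrable_of_compactSpace γ) (ha.add hb) fun p => h p.1 p.2).trans_eq
    (integral_add ha hb)

theorem bddBelow_majorantValues (μ₀ μ₁ : Measure M) [IsProbabilityMeasure μ₀]
    [IsProbabilityMeasure μ₁] (f : C(M × M, ℝ)) : BddBelow (majorantValues μ₀ μ₁ f) := by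
  refine ⟨∫ p, f p ∂μ₀.prod μ₁, ?_⟩
  rintro _ ⟨a, b, h, rfl⟩
  exact (isPlan_prod μ₀ μ₁).integral_le h

variable [IsProbabilityMeasure μ₀] [IsProbabilityMeasure μ₁]

theorem sInf_majorantValues_le {f : C(M × M, ℝ)} {a b : C(M, ℝ)}
    (h : ∀ x y, f (x, y) ≤ a x + b y) :
    sInf (majorantValues μ₀ μ₁ f) ≤ ∫ x, a x ∂μ₀ + ∫ y, b y ∂μ₁ :=
  csInf_le (bddBelow_majorantValues μ₀ μ₁ f) ⟨a, b, h, rfl⟩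

theorem sInf_majorantValues_smul_le {t : ℝ} (ht : 0 < t) (f : C(M × M, ℝ)) :
    sInf (majorantValues μ₀ μ₁ (t • f)) ≤ t * sInf (majorantValues μ₀ μ₁ f) := by
  rw [← div_le_iff₀' ht]
  refine le_csInf (majorantValues_nonempty μ₀ μ₁ f) ?_
  rintro _ ⟨a, b, h, rfl⟩
  rw [div_le_iff₀' ht]
  refine (sInf_majorantValues_le (a := t • a) (b := t • b) fun x y => ?_).trans_eq ?_
  · simpa [mul_add] using mul_le_mul_of_nonneg_left (h x y) ht.le
  · simp [integral_const_mul, mul_add]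

theorem sInf_majorantValues_smul {t : ℝ} (ht : 0 < t) (f : C(M × M, ℝ)) :
    sInf (majorantValues μ₀ μ₁ (t • f)) = t * sInf (majorantValues μ₀ μ₁ f) := by
  refine (sInf_majorantValues_smul_le ht f).antisymm ?_
  have h := sInf_majorantValues_smul_le (μ₀ := μ₀) (μ₁ := μ₁) (inv_pos.2 ht) (t • f)
  rwa [inv_smul_smul₀ ht.ne', le_inv_mul_iff₀ ht] at h

theorem sInf_majorantValues_add (f g : C(M × M, ℝ)) :
    sInf (majorantValues μ₀ μ₁ (f + g)) ≤
      sInf (majorantValues μ₀ μ₁ f) + sInf (majorantValues μ₀ μ₁ g) := by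
  rw [← sub_le_iff_le_add]
  refine le_csInf (majorantValues_nonempty μ₀ μ₁ f) ?_
  rintro _ ⟨a, b, h, rfl⟩
  rw [sub_le_comm]
  refine le_csInf (majorantValues_nonempty μ₀ μ₁ g) ?_
  rintro _ ⟨a', b', h', rfl⟩
  have hsum := sInf_majorantValues_le (μ₀ := μ₀) (μ₁ := μ₁) (f := f + g) (a := a + a')
    (b := b + b') fun x y => by
      simp only [ContinuousMap.add_apply]
      linarith [h x y, h' x y]
  simp only [ContinuousMap.add_apply] at hsum
  rw [integral_add (a.integrable_of_compactSpace μ₀) (a'.integrable_of_compactSpace μ₀),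
    integral_add (b.integrable_of_compactSpace μ₁) (b'.integrable_of_compactSpace μ₁)] at hsum
  linarith

/-- Riesz–Markov–Kakutani on a compact space, with functionals on `C(X, ℝ)`. -/
theorem exists_measure_integral_eq {X : Type*} [TopologicalSpace X] [CompactSpace X] [T2Space X]
    [MeasurableSpace X] [BorelSpace X] (L : C(X, ℝ) →ₗ[ℝ] ℝ) (hL : ∀ f, 0 ≤ f → 0 ≤ L f) :
    ∃ γ : Measure X, IsFiniteMeasure γ ∧ ∀ f : C(X, ℝ), ∫ x, f x ∂γ = L f := by
  let Λ : C_c(X, ℝ) →ₚ[ℝ] ℝ := PositiveLinearMap.mk₀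
    { toFun := fun f => L f.toContinuousMap
      map_add' := fun f g => L.map_add f.toContinuousMap g.toContinuousMap
      map_smul' := fun t f => L.map_smul t f.toContinuousMap }
    fun f hf => hL f.toContinuousMap hf
  exact ⟨RealRMK.rieszMeasure Λ, inferInstance, fun f =>
    RealRMK.integral_rieszMeasure Λ (CompactlySupportedContinuousMap.continuousMapEquiv f)⟩

theorem exists_isPlan_le_integral {f : C(M × M, ℝ)} {D : ℝ}
    (hD : ∀ a b : C(M, ℝ), (∀ x y, f (x, y) ≤ a x + b y) →
      D ≤ ∫ x, a x ∂μ₀ + ∫ y, b y ∂μ₁) :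
    ∃ γ : Measure (M × M), IsPlan μ₀ μ₁ γ ∧ D ≤ ∫ p, f p ∂γ := by
  obtain ⟨L, hLf, hL⟩ := exists_linearMap_eq_of_sublinear
    (fun g => sInf (majorantValues μ₀ μ₁ g)) (fun t ht g => sInf_majorantValues_smul ht g)
    sInf_majorantValues_add f
  have hle {g : C(M × M, ℝ)} {a b : C(M, ℝ)} (h : ∀ x y, g (x, y) ≤ a x + b y) :
      L g ≤ ∫ x, a x ∂μ₀ + ∫ y, b y ∂μ₁ :=
    (hL g).trans (sInf_majorantValues_le h)
  have hpos (g : C(M × M, ℝ)) (hg : 0 ≤ g) : 0 ≤ L g := by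
    have h := hle (g := -g) (a := 0) (b := 0) fun x y => by simpa using hg (x, y)
    simpa using h
  have hfst (a : C(M, ℝ)) : L (a.comp ContinuousMap.fst) = ∫ x, a x ∂μ₀ := by
    have h₁ := hle (g := a.comp ContinuousMap.fst) (a := a) (b := 0) fun x y => by simp
    have h₂ := hle (g := -a.comp ContinuousMap.fst) (a := -a) (b := 0) fun x y => by simp
    simp only [map_neg, ContinuousMap.neg_apply, integral_neg, ContinuousMap.zero_apply,
      integral_zero, add_zero] at h₁ h₂
    linarith
  have hsnd (b : C(M, ℝ)) : L (b.comp ContinuousMap.snd) = ∫ y, b y ∂μ₁ := by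
    have h₁ := hle (g := b.comp ContinuousMap.snd) (a := 0) (b := b) fun x y => by simp
    have h₂ := hle (g := -b.comp ContinuousMap.snd) (a := 0) (b := -b) fun x y => by simp
    simp only [map_neg, ContinuousMap.neg_apply, integral_neg, ContinuousMap.zero_apply,
      integral_zero, zero_add] at h₁ h₂
    linarith
  obtain ⟨γ, hγ, hγL⟩ := exists_measure_integral_eq L hpos
  have h₀ : γ.map Prod.fst = μ₀ := by
    refine ext_of_forall_integral_eq_of_IsFiniteMeasure fun a => ?_
    rw [integral_map measurable_fst.aemeasurable a.continuous.aestronglyMeasurable]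
    exact (hγL _).trans (hfst a.toContinuousMap)
  have h₁ : γ.map Prod.snd = μ₁ := by
    refine ext_of_forall_integral_eq_of_IsFiniteMeasure fun b => ?_
    rw [integral_map measurable_snd.aemeasurable b.continuous.aestronglyMeasurable]
    exact (hγL _).trans (hsnd b.toContinuousMap)
  refine ⟨γ, ⟨⟨?_⟩, h₀, h₁⟩, ?_⟩
  · rw [← preimage_univ (f := Prod.fst), ← Measure.map_apply measurable_fst .univ, h₀,
      measure_univ]
  · rw [hγL, hLf]
    refine le_csInf (majorantValues_nonempty μ₀ μ₁ f) ?_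
    rintro _ ⟨a, b, h, rfl⟩
    exact hD a b h

end Plans

theorem IsAdmPair.sub_le {M : Type*} [TopologicalSpace M] {c : M → M → ℝ} {φ₀ φ₁ : M → ℝ}
    (h : IsAdmPair c φ₀ φ₁) (x y : M) :
    φ₁ y - φ₀ x ≤ c x y := by
  linarith [(h.2.2.1 y).2 ⟨x, rfl⟩]

section AdmissiblePairs

variable {M : Type*} [TopologicalSpace M] [CompactSpace M] [Nonempty M]

/-- Any pair `(f, g)` with `g y - f x ≤ c (x, y)` is improved by an admissible pair whose first
entry inherits the modulus of continuity of `c`. -/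
theorem exists_isAdmPair_of_sub_le (c : C(M × M, ℝ)) {f g : C(M, ℝ)}
    (h : ∀ x y, g y - f x ≤ c (x, y)) :
    ∃ φ₀ : C(M, ℝ), (∀ x, φ₀ x ≤ f x) ∧
      (∀ y, g y ≤ infTransform (c.comp .prodSwap).curry φ₀ y) ∧
      (∀ x x', dist (φ₀ x) (φ₀ x') ≤ dist (c.curry x) (c.curry x')) ∧
      IsAdmPair (fun x y => c (x, y)) φ₀ (infTransform (c.comp .prodSwap).curry φ₀) := by
  set T := infTransform (c.comp .prodSwap).curry
  set S := infTransform c.curry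
  have T_le (u x y) : T u y ≤ u x + c (x, y) := infTransform_le _ u x y
  have S_le (u x y) : S u x ≤ u y + c (x, y) := infTransform_le _ u y x
  have T_ex (u y) : ∃ x, T u y = u x + c (x, y) := exists_infTransform_eq _ u y
  have S_ex (u x) : ∃ y, S u x = u y + c (x, y) := exists_infTransform_eq _ u x
  have h_le (x) : (-S (-T f)) x ≤ f x := by
    obtain ⟨y, hy⟩ := S_ex (-T f) x
    simp only [ContinuousMap.neg_apply] at hy ⊢
    linarith [T_le f x y]
  have h_eq : T (-S (-T f)) = T f := by
    ext y
    refine le_antisymm ?_ ?_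
    · obtain ⟨x, hx⟩ := T_ex f y
      linarith [T_le (-S (-T f)) x y, h_le x]
    · obtain ⟨x, hx⟩ := T_ex (-S (-T f)) y
      have h := S_le (-T f) x y
      simp only [ContinuousMap.neg_apply] at hx h
      linarith
  refine ⟨-S (-T f), h_le, fun y => ?_, fun x x' => ?_, map_continuous _, map_continuous _,
    fun y => ⟨T_ex _ y, ?_⟩, fun x => ⟨?_, ?_⟩⟩
  · rw [h_eq]
    obtain ⟨x, hx⟩ := T_ex f y
    linarith [h x y]
  · simpa using dist_infTransform_apply_le c.curry (-T f) x x'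
  · rintro _ ⟨x, rfl⟩
    exact T_le _ x y
  · obtain ⟨y, hy⟩ := S_ex (-T f) x
    refine ⟨y, ?_⟩
    rw [h_eq]
    simp only [ContinuousMap.neg_apply] at hy ⊢
    linarith
  · rintro _ ⟨y, rfl⟩
    have h := S_le (-T f) x y
    rw [h_eq]
    simp only [ContinuousMap.neg_apply] at h ⊢
    linarith

theorem exists_isAdmPair_forall_le [MeasurableSpace M] [OpensMeasurableSpace M]
    (c : C(M × M, ℝ)) (μ₀ μ₁ : Measure M) [IsProbabilityMeasure μ₀] [IsProbabilityMeasure μ₁] :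
    ∃ φ₀ φ₁ : C(M, ℝ), IsAdmPair (fun x y => c (x, y)) φ₀ φ₁ ∧
      ∀ f g : C(M, ℝ), (∀ x y, g y - f x ≤ c (x, y)) →
        ∫ y, g y ∂μ₁ - ∫ x, f x ∂μ₀ ≤ ∫ y, φ₁ y ∂μ₁ - ∫ x, φ₀ x ∂μ₀ := by
  obtain ⟨x₀⟩ := ‹Nonempty M›
  have : Nonempty M := ⟨x₀⟩
  set T := infTransform (c.comp .prodSwap).curry
  have T_le (u x y) : T u y ≤ u x + c (x, y) := infTransform_le _ u x y
  have mono {μ : Measure M} [IsProbabilityMeasure μ] {u v : C(M, ℝ)} (h : ∀ x, u x ≤ v x) :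
      ∫ x, u x ∂μ ≤ ∫ x, v x ∂μ :=
    integral_mono (u.integrable_of_compactSpace μ) (v.integrable_of_compactSpace μ) h
  have hcont : Continuous fun f : C(M, ℝ) => ∫ y, T f y ∂μ₁ - ∫ x, f x ∂μ₀ :=
    ((ContinuousMap.continuous_integral μ₁).comp (continuous_infTransform _)).sub
      (ContinuousMap.continuous_integral μ₀)
  obtain ⟨F, -, hF⟩ := (isCompact_setOf_dist_le c.curry x₀).exists_isMaxOn
    ⟨0, by simp⟩ hcont.continuousOn
  obtain ⟨φ₀, h₀, h₁, -, hadm⟩ := exists_isAdmPair_of_sub_le c (f := F) (g := T F)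
    fun x y => by linarith [T_le F x y]
  refine ⟨φ₀, T φ₀, hadm, fun f g hfg => ?_⟩
  obtain ⟨ψ, hψ₀, hψ₁, hψ, -⟩ := exists_isAdmPair_of_sub_le c hfg
  have hmax : ∫ y, T (ψ - .const M (ψ x₀)) y ∂μ₁ - ∫ x, (ψ - .const M (ψ x₀)) x ∂μ₀ ≤
      ∫ y, T F y ∂μ₁ - ∫ x, F x ∂μ₀ := hF ⟨by simp, by simpa using hψ⟩
  have hshift : ∫ y, (T ψ - .const M (ψ x₀)) y ∂μ₁ ≤ ∫ y, T (ψ - .const M (ψ x₀)) y ∂μ₁ := by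
    refine mono fun y => le_infTransform_iff.2 fun x => ?_
    have h := T_le ψ x y
    simp only [ContinuousMap.sub_apply, ContinuousMap.const_apply, ContinuousMap.curry_apply,
      ContinuousMap.comp_apply, ContinuousMap.prodSwap_apply] at h ⊢
    linarith
  simp only [ContinuousMap.sub_apply, ContinuousMap.const_apply] at hmax hshift
  rw [integral_sub (ψ.integrable_of_compactSpace μ₀) (integrable_const _)] at hmax
  rw [integral_sub ((T ψ).integrable_of_compactSpace μ₁) (integrable_const _)] at hshift
  simp only [integral_const, probReal_univ, one_smul] at hmax hshift
  have hg := mono (μ := μ₁) hψ₁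
  have hf := mono (μ := μ₀) hψ₀
  have hF₀ := mono (μ := μ₀) h₀
  have hF₁ := mono (μ := μ₁) h₁
  linarith

end AdmissiblePairs

/-- Kantorovich duality on a compact metric space: the minimal transport cost
equals the maximal dual value over admissible Kantorovich pairs, and both the
minimum and the maximum are attained. -/
theorem kantorovich_duality {M : Type*} [MetricSpace M] [CompactSpace M]
    [Nonempty M] [MeasurableSpace M] [BorelSpace M]
    (c : M → M → ℝ) (hc : Continuous fun p : M × M => c p.1 p.2)
    (μ₀ μ₁ : Measure M) [IsProbabilityMeasure μ₀] [IsProbabilityMeasure μ₁] :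
    ∃ γ : Measure (M × M), IsPlan μ₀ μ₁ γ ∧
      ∃ φ₀ φ₁ : M → ℝ, IsAdmPair c φ₀ φ₁ ∧
        (∀ γ' : Measure (M × M), IsPlan μ₀ μ₁ γ' →
          (∫ p, c p.1 p.2 ∂γ) ≤ ∫ p, c p.1 p.2 ∂γ') ∧
        (∀ ψ₀ ψ₁ : M → ℝ, IsAdmPair c ψ₀ ψ₁ →
          (∫ y, ψ₁ y ∂μ₁) - (∫ x, ψ₀ x ∂μ₀) ≤
            (∫ y, φ₁ y ∂μ₁) - ∫ x, φ₀ x ∂μ₀) ∧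
        (∫ p, c p.1 p.2 ∂γ) = (∫ y, φ₁ y ∂μ₁) - ∫ x, φ₀ x ∂μ₀ := by
  obtain ⟨φ₀, φ₁, hφ, hmax⟩ := exists_isAdmPair_forall_le ⟨_, hc⟩ μ₀ μ₁
  have weak (γ : Measure (M × M)) (hγ : IsPlan μ₀ μ₁ γ) :
      (∫ y, φ₁ y ∂μ₁) - ∫ x, φ₀ x ∂μ₀ ≤ ∫ p, c p.1 p.2 ∂γ := by
    have h := hγ.integral_le (f := -⟨_, hc⟩) (a := φ₀) (b := -φ₁) fun x y => by
      have := hφ.sub_le x y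
      simp only [ContinuousMap.neg_apply, ContinuousMap.coe_mk] at this ⊢
      linarith
    simp only [ContinuousMap.neg_apply, ContinuousMap.coe_mk, integral_neg] at h
    linarith
  obtain ⟨γ, hγ, hle⟩ := exists_isPlan_le_integral (μ₀ := μ₀) (μ₁ := μ₁) (f := -⟨_, hc⟩)
    (D := (∫ x, φ₀ x ∂μ₀) - ∫ y, φ₁ y ∂μ₁) fun a b hab => by
      have h := hmax a (-b) fun x y => by
        have := hab x y
        simp only [ContinuousMap.neg_apply, ContinuousMap.coe_mk] at this ⊢
        linarith
      simp only [ContinuousMap.neg_apply, integral_neg] at h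
      linarith
  simp only [ContinuousMap.neg_apply, ContinuousMap.coe_mk, integral_neg] at hle
  have heq : ∫ p, c p.1 p.2 ∂γ = (∫ y, φ₁ y ∂μ₁) - ∫ x, φ₀ x ∂μ₀ :=
    le_antisymm (by linarith) (weak γ hγ)
  refine ⟨γ, hγ, φ₀, φ₁, hφ, fun γ' hγ' => heq.trans_le (weak γ' hγ'), fun ψ₀ ψ₁ hψ => ?_, heq⟩
  exact hmax ⟨ψ₀, hψ.1⟩ ⟨ψ₁, hψ.2.1⟩ hψ.sub_le
end
end

section
/- For every pair of points (x,y) ∈ M × M, one has c(x,y) = max over all admissible Kantorovich pairs (φ₀,φ₁) of the quantity φ₁(y) − φ₀(x), and the maximum is attained (possibly by a different admissible pair for different (x,y)). -/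
open Set

noncomputable section

/-- For every pair of points `(x,y)`, the cost `c(x,y)` is the maximum of
`φ₁ y - φ₀ x` over all admissible Kantorovich pairs `(φ₀, φ₁)`, and the
maximum is attained. -/
theorem cost_eq_max_over_kantorovich_pairs {M : Type*} [MetricSpace M]
    [CompactSpace M] [Nonempty M]
    (c : M → M → ℝ) (hc : Continuous fun p : M × M => c p.1 p.2)
    (htri : ∀ x z y : M, c x y ≤ c x z + c z y)
    (x y : M) :
    IsGreatest { r | ∃ φ₀ φ₁ : M → ℝ, IsAdmPair c φ₀ φ₁ ∧ r = φ₁ y - φ₀ x }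
      (c x y) := by
  constructor
  · have hcont (a : M) : ContinuousOn (fun b => c x b - c a b) univ :=
      ((hc.comp (by fun_prop : Continuous fun b : M => (x, b))).sub
        (hc.comp (by fun_prop : Continuous fun b : M => (a, b)))).continuousOn
    have hmax (a : M) : IsGreatest ((fun b => c x b - c a b) '' univ)
        (sSup ((fun b => c x b - c a b) '' univ)) :=
      (isCompact_univ.image_of_continuousOn (hcont a)).isGreatest_sSup
        (univ_nonempty.image _)
    have hzero : sSup ((fun b => c x b - c x b) '' univ) = 0 := by
      simp
    refine ⟨fun a => sSup ((fun b => c x b - c a b) '' univ), fun b => c x b,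
      ⟨?_, ?_, fun b => ⟨⟨x, ?_⟩, ?_⟩, fun a => ⟨?_, ?_⟩⟩, ?_⟩
    · refine isCompact_univ.continuous_sSup (f := fun a b => c x b - c a b) ?_
      exact (hc.comp (by fun_prop : Continuous fun p : M × M => (x, p.2))).sub hc
    · exact hc.comp (by fun_prop : Continuous fun b : M => (x, b))
    · simp only [hzero, zero_add]
    · rintro _ ⟨a, rfl⟩
      have := (hmax a).2 (mem_image_of_mem _ (mem_univ b))
      simp only at this ⊢
      linarith
    · obtain ⟨b, -, hb⟩ := (hmax a).1
      exact ⟨b, hb.symm⟩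
    · rintro _ ⟨b, rfl⟩
      exact (hmax a).2 (mem_image_of_mem _ (mem_univ b))
    · simp only [hzero, sub_zero]
  · rintro _ ⟨φ₀, φ₁, ⟨-, -, hmin, -⟩, rfl⟩
    linarith [(hmin y).2 ⟨x, rfl⟩]
end
end

section
/- (Classical HJB equation for a smooth value function) Assume f and L satisfy (A1), (A2), (L1), (L2), and the initial cost I is continuous. If the value function V is of class C¹ on (0,T) × ℝⁿ, then for every (t,x) ∈ (0,T) × ℝⁿ it satisfies the Hamilton–Jacobi–Bellman equation V_t(t,x) + sup_{u∈U} ( ⟨V_x(t,x), f(x,u)⟩ − L(x,u,t) ) = 0, together with the initial condition V(0,x) = I(x). -/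
open MeasureTheory Set
open scoped RealInnerProductSpace

noncomputable section

/-- An admissible control–trajectory pair on `[a,b]`. -/
def IsAdmissible {n m : ℕ} (f : En n → En m → En n) (U : Set (En m)) (a b : ℝ)
    (u : ℝ → En m) (γ : ℝ → En n) : Prop :=
  Measurable u ∧ (∀ s ∈ Icc a b, u s ∈ U) ∧ ContinuousOn γ (Icc a b) ∧
    ∀ s ∈ Icc a b, γ s = γ a + ∫ r in a..s, f (γ r) (u r)

/-- The value function of the Bolza problem. -/
def valueFun {n m : ℕ} (f : En n → En m → En n) (U : Set (En m))
    (L : En n → En m → ℝ → ℝ) (I : En n → ℝ) (t : ℝ) (x : En n) : ℝ :=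
  sInf { J | ∃ u γ, IsAdmissible f U 0 t u γ ∧ γ t = x ∧
      J = (∫ s in (0:ℝ)..t, L (γ s) (u s) s) + I (γ 0) }

/-- The Hamiltonian `H(x,p,t) = sup_{u ∈ U} (⟨p, f(x,u)⟩ - L(x,u,t))`. -/
def ham {n m : ℕ} (f : En n → En m → En n) (U : Set (En m))
    (L : En n → En m → ℝ → ℝ) (x p : En n) (t : ℝ) : ℝ :=
  sSup { r | ∃ u ∈ U, r = ⟪p, f x u⟫ - L x u t }


namespace IsAdmissible

variable {n m : ℕ} {f : En n → En m → En n} {U : Set (En m)} {a b c : ℝ}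
  {u : ℝ → En m} {γ : ℝ → En n}

/-- A continuous function of state, control and time is integrable along an admissible pair. -/
theorem intervalIntegrable {E : Type*} [NormedAddCommGroup E] [SecondCountableTopology E]
    (h : IsAdmissible f U a b u γ) (hU : IsCompact U) {g : En n → En m → ℝ → E}
    (hg : Continuous fun p : En n × En m × ℝ => g p.1 p.2.1 p.2.2) (hab : a ≤ b) :
    IntervalIntegrable (fun s => g (γ s) (u s) s) volume a b := by
  obtain ⟨hu, huU, hγ, -⟩ := h
  rw [intervalIntegrable_iff_integrableOn_Icc_of_le hab]
  obtain ⟨C, hC⟩ := (((isCompact_Icc.image_of_continuousOn hγ).prod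
    (hU.prod isCompact_Icc)).exists_bound_of_continuousOn hg.continuousOn)
  refine Integrable.of_bound ?_ C ?_
  · exact hg.comp_aestronglyMeasurable <|
      (hγ.aestronglyMeasurable measurableSet_Icc).prodMk
        (hu.aestronglyMeasurable.prodMk measurable_id.aestronglyMeasurable)
  · filter_upwards [ae_restrict_mem measurableSet_Icc] with s hs
    exact hC (γ s, u s, s) ⟨mem_image_of_mem γ hs, huU s hs, hs⟩

theorem intervalIntegrable_velocity (h : IsAdmissible f U a b u γ) (hU : IsCompact U)
    (hf : Continuous fun p : En n × En m => f p.1 p.2) (hab : a ≤ b) :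
    IntervalIntegrable (fun s => f (γ s) (u s)) volume a b :=
  h.intervalIntegrable (g := fun x v _ => f x v) hU
    (hf.comp (continuous_fst.prodMk (continuous_fst.comp continuous_snd))) hab

theorem mono_right (h : IsAdmissible f U a b u γ) (hcb : c ≤ b) :
    IsAdmissible f U a c u γ :=
  ⟨h.1, fun s hs => h.2.1 s ⟨hs.1, hs.2.trans hcb⟩, h.2.2.1.mono (Icc_subset_Icc_right hcb),
    fun s hs => h.2.2.2 s ⟨hs.1, hs.2.trans hcb⟩⟩

theorem sub_eq_integral (h : IsAdmissible f U a b u γ) (hU : IsCompact U)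
    (hf : Continuous fun p : En n × En m => f p.1 p.2) (hac : a ≤ c) {s : ℝ} (hcs : c ≤ s)
    (hsb : s ≤ b) : γ s - γ c = ∫ r in c..s, f (γ r) (u r) := by
  have hint := h.intervalIntegrable_velocity hU hf (hac.trans (hcs.trans hsb))
  rw [h.2.2.2 s ⟨hac.trans hcs, hsb⟩, h.2.2.2 c ⟨hac, hcs.trans hsb⟩, add_sub_add_left_eq_sub,
    intervalIntegral.integral_interval_sub_left]
  · exact (h.mono_right hsb).intervalIntegrable_velocity hU hf (hac.trans hcs)
  · exact (h.mono_right (hcs.trans hsb)).intervalIntegrable_velocity hU hf hac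

theorem mono_left (h : IsAdmissible f U a b u γ) (hU : IsCompact U)
    (hf : Continuous fun p : En n × En m => f p.1 p.2) (hac : a ≤ c) :
    IsAdmissible f U c b u γ :=
  ⟨h.1, fun s hs => h.2.1 s ⟨hac.trans hs.1, hs.2⟩, h.2.2.1.mono (Icc_subset_Icc_left hac),
    fun s hs => by rw [← h.sub_eq_integral hU hf hac hs.1 hs.2]; abel⟩

/-- Two admissible pairs that match at an intermediate time can be glued. -/
theorem exists_glue {u' : ℝ → En m} {γ' : ℝ → En n} (h : IsAdmissible f U a b u γ)
    (h' : IsAdmissible f U b c u' γ') (hU : IsCompact U)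
    (hf : Continuous fun p : En n × En m => f p.1 p.2) (hab : a ≤ b) (hbc : b ≤ c)
    (hγ : γ b = γ' b) :
    ∃ v η, IsAdmissible f U a c v η ∧ (∀ s ≤ b, v s = u s ∧ η s = γ s) ∧
      (∀ s > b, v s = u' s ∧ η s = γ' s) ∧ η c = γ' c := by
  set v : ℝ → En m := (Iic b).piecewise u u'
  set η : ℝ → En n := (Iic b).piecewise γ γ'
  have hl : ∀ s ≤ b, v s = u s ∧ η s = γ s := fun s hs =>
    ⟨piecewise_eq_of_mem _ _ _ hs, piecewise_eq_of_mem _ _ _ hs⟩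
  have hr : ∀ s > b, v s = u' s ∧ η s = γ' s := fun s hs =>
    ⟨piecewise_eq_of_notMem _ _ _ (not_le.2 hs), piecewise_eq_of_notMem _ _ _ (not_le.2 hs)⟩
  have hr' : ∀ s ≥ b, η s = γ' s := fun s hs => by
    rcases hs.eq_or_lt with rfl | hs
    · rw [(hl _ le_rfl).2, hγ]
    · exact (hr s hs).2
  have hI₁ : ∀ s ∈ Icc a b, ∫ r in a..s, f (η r) (v r) = ∫ r in a..s, f (γ r) (u r) := by
    intro s hs
    refine intervalIntegral.integral_congr fun r hrs => ?_
    rw [uIcc_of_le hs.1] at hrs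
    obtain ⟨h1, h2⟩ := hl r (hrs.2.trans hs.2)
    simp only [h1, h2]
  have hI₂ : ∀ s ∈ Icc b c, ∫ r in b..s, f (η r) (v r) = ∫ r in b..s, f (γ' r) (u' r) := by
    intro s hs
    refine intervalIntegral.integral_congr_ae (Filter.Eventually.of_forall fun r hrs => ?_)
    rw [uIoc_of_le hs.1] at hrs
    obtain ⟨h1, h2⟩ := hr r hrs.1
    simp only [h1, h2]
  have hint₁ : IntervalIntegrable (fun r => f (η r) (v r)) volume a b := by
    refine (h.intervalIntegrable_velocity hU hf hab).congr fun r hrs => ?_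
    rw [uIoc_of_le hab] at hrs
    obtain ⟨h1, h2⟩ := hl r hrs.2
    simp only [h1, h2]
  have hint₂ : ∀ s ∈ Icc b c, IntervalIntegrable (fun r => f (η r) (v r)) volume b s := by
    intro s hs
    refine ((h'.mono_right hs.2).intervalIntegrable_velocity hU hf hs.1).congr fun r hrs => ?_
    rw [uIoc_of_le hs.1] at hrs
    obtain ⟨h1, h2⟩ := hr r hrs.1
    simp only [h1, h2]
  refine ⟨v, η, ⟨h.1.piecewise measurableSet_Iic h'.1, ?_, ?_, ?_⟩, hl, hr, hr' c hbc⟩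
  · intro s hs
    rcases le_or_gt s b with hsb | hsb
    · rw [(hl s hsb).1]
      exact h.2.1 s ⟨hs.1, hsb⟩
    · rw [(hr s hsb).1]
      exact h'.2.1 s ⟨hsb.le, hs.2⟩
  · rw [← Icc_union_Icc_eq_Icc hab hbc]
    exact (h.2.2.1.congr fun s hs => (hl s hs.2).2).union_of_isClosed
      (h'.2.2.1.congr fun s hs => hr' s hs.1) isClosed_Icc isClosed_Icc
  · intro s hs
    rw [(hl a hab).2]
    rcases le_total s b with hsb | hsb
    · rw [(hl s hsb).2, hI₁ s ⟨hs.1, hsb⟩]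
      exact h.2.2.2 s ⟨hs.1, hsb⟩
    · rw [hr' s hsb, h'.2.2.2 s ⟨hsb, hs.2⟩, ← hγ, h.2.2.2 b ⟨hab, le_rfl⟩,
        ← intervalIntegral.integral_add_adjacent_intervals hint₁ (hint₂ s ⟨hsb, hs.2⟩),
        hI₁ b ⟨hab, le_rfl⟩, hI₂ s ⟨hsb, hs.2⟩, add_assoc]

end IsAdmissible

/-- A constant control can be driven backwards from any state, over a time span that depends only
on the growth constant of the dynamics. -/
theorem exists_isAdmissible_const {n m : ℕ} {f : En n → En m → En n} {U : Set (En m)}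
    {K₀ K₁ : ℝ} (hK₀ : 0 < K₀) (hA1 : ∀ x u, ‖f x u‖ ≤ K₀ * (1 + ‖x‖ + ‖u‖))
    (hK₁ : 0 < K₁) (hA2 : ∀ x₁ x₂ u, u ∈ U → ‖f x₂ u - f x₁ u‖ ≤ K₁ * ‖x₂ - x₁‖)
    {v : En m} (hv : v ∈ U) {a b : ℝ} (hab : a ≤ b) (hba : 2 * K₀ * (b - a) ≤ 1) (x : En n) :
    ∃ γ, IsAdmissible f U a b (fun _ => v) γ ∧ γ b = x := by
  set R : ℝ := 1 + ‖x‖ + ‖v‖ with hR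
  have hR0 : 0 < R := by positivity
  have hlip : ∀ s : Set (En n), LipschitzOnWith K₁.toNNReal (fun y => f y v) s := fun s =>
    (LipschitzWith.of_dist_le_mul fun y z => by
      rw [dist_eq_norm, dist_eq_norm, Real.coe_toNNReal _ hK₁.le]
      exact hA2 z y v hv).lipschitzOnWith
  have hPL : IsPicardLindelof (fun _ y => f y v) (⟨b, hab, le_rfl⟩ : Icc a b) x R.toNNReal 0
      (2 * K₀ * R).toNNReal K₁.toNNReal := by
    refine IsPicardLindelof.of_time_independent (fun y hy => ?_) (hlip _) ?_
    · rw [Real.coe_toNNReal _ (by positivity)]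
      rw [mem_closedBall_iff_norm, Real.coe_toNNReal _ hR0.le] at hy
      have : ‖y‖ ≤ ‖x‖ + R := by
        calc ‖y‖ = ‖x + (y - x)‖ := by congr 1; abel
          _ ≤ ‖x‖ + ‖y - x‖ := norm_add_le _ _
          _ ≤ _ := by gcongr
      refine (hA1 y v).trans ?_
      rw [mul_comm 2 K₀, mul_assoc]
      gcongr
      linarith
    · rw [Real.coe_toNNReal _ (by positivity), Real.coe_toNNReal _ hR0.le]
      simp only [sub_self, NNReal.coe_zero, sub_zero]
      rw [max_eq_right (by linarith)]
      nlinarith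
  obtain ⟨γ, hγb, hγ⟩ := hPL.exists_eq_forall_mem_Icc_hasDerivWithinAt₀
  have hcont : ContinuousOn γ (Icc a b) := fun s hs => (hγ s hs).continuousWithinAt
  have hfc : ContinuousOn (fun s => f (γ s) v) (Icc a b) :=
    (hlip univ).continuousOn.comp hcont fun _ _ => mem_univ _
  refine ⟨γ, ⟨measurable_const, fun _ _ => hv, hcont, fun s hs => ?_⟩, hγb⟩
  have hsub : Icc a s ⊆ Icc a b := Icc_subset_Icc_right hs.2
  rw [intervalIntegral.integral_eq_sub_of_hasDerivAt_of_le hs.1 (hcont.mono hsub)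
    (fun r hr => (hγ r (hsub (Ioo_subset_Icc_self hr))).hasDerivAt
      (Icc_mem_nhds hr.1 (hr.2.trans_le hs.2)))]
  · abel
  · exact (hfc.mono hsub).intervalIntegrable_of_Icc hs.1

/-- Every terminal state is reached by some admissible pair. -/
theorem exists_isAdmissible {n m : ℕ} {f : En n → En m → En n} {U : Set (En m)}
    (hU : IsCompact U) (hUne : U.Nonempty) (hf : Continuous fun p : En n × En m => f p.1 p.2)
    {K₀ K₁ : ℝ} (hK₀ : 0 < K₀) (hA1 : ∀ x u, ‖f x u‖ ≤ K₀ * (1 + ‖x‖ + ‖u‖))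
    (hK₁ : 0 < K₁) (hA2 : ∀ x₁ x₂ u, u ∈ U → ‖f x₂ u - f x₁ u‖ ≤ K₁ * ‖x₂ - x₁‖)
    {a b : ℝ} (hab : a ≤ b) (x : En n) :
    ∃ u γ, IsAdmissible f U a b u γ ∧ γ b = x := by
  obtain ⟨v, hv⟩ := hUne
  obtain ⟨N, hN⟩ := exists_nat_ge (2 * K₀ * (b - a))
  induction N generalizing b x with
  | zero =>
    obtain ⟨γ, hγ⟩ := exists_isAdmissible_const hK₀ hA1 hK₁ hA2 hv hab
      (hN.trans (by norm_num)) x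
    exact ⟨_, γ, hγ⟩
  | succ N ih =>
    have h2 : 0 < 2 * K₀ := by positivity
    have hstep : 2 * K₀ * (b - max a (b - 1 / (2 * K₀))) ≤ 1 := by
      calc _ ≤ 2 * K₀ * (1 / (2 * K₀)) := by
            gcongr
            linarith [le_max_right a (b - 1 / (2 * K₀))]
        _ = 1 := by field_simp
    have hmb : max a (b - 1 / (2 * K₀)) ≤ b := max_le hab (by
      have : 0 < 1 / (2 * K₀) := by positivity
      linarith)
    obtain ⟨γ₂, hγ₂, hx⟩ := exists_isAdmissible_const hK₀ hA1 hK₁ hA2 hv hmb hstep x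
    obtain ⟨u₁, γ₁, hγ₁, hm⟩ := ih (le_max_left a (b - 1 / (2 * K₀)))
      (γ₂ (max a (b - 1 / (2 * K₀)))) (by
        rcases max_cases a (b - 1 / (2 * K₀)) with ⟨h, -⟩ | ⟨h, -⟩ <;> rw [h]
        · simp
        · have : 2 * K₀ * (b - 1 / (2 * K₀) - a) = 2 * K₀ * (b - a) - 1 := by
            field_simp
            ring
          push_cast at hN
          linarith)
    obtain ⟨u, γ, hγ, -, -, hc⟩ := hγ₁.exists_glue hγ₂ hU hf (le_max_left _ _) hmb hm
    exact ⟨u, γ, hγ, hc.trans hx⟩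

namespace IsAdmissible

variable {n m : ℕ} {f : En n → En m → En n} {U : Set (En m)} {a b : ℝ}
  {u : ℝ → En m} {γ : ℝ → En n}

/-- A priori bound for trajectories in terms of their terminal state. -/
theorem norm_le (h : IsAdmissible f U a b u γ) (hU : IsCompact U)
    (hf : Continuous fun p : En n × En m => f p.1 p.2) {K₀ : ℝ} (hK₀ : 0 < K₀)
    (hA1 : ∀ x u, ‖f x u‖ ≤ K₀ * (1 + ‖x‖ + ‖u‖)) {ρ : ℝ} (hρ : ∀ v ∈ U, ‖v‖ ≤ ρ)
    {s : ℝ} (hs : s ∈ Icc a b) :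
    ‖γ s‖ ≤ 2 * (1 + ρ + ‖γ b‖) * Real.exp (2 * K₀ * (b - a)) := by
  have hab : a ≤ b := hs.1.trans hs.2
  have hρ0 : 0 ≤ ρ := (norm_nonneg _).trans (hρ _ (h.2.1 s hs))
  obtain ⟨s₀, hs₀, hmax⟩ := isCompact_Icc.exists_isMaxOn (nonempty_Icc.2 hab)
    (f := fun s => Real.exp (-(2 * K₀ * (b - s))) * (1 + ρ + ‖γ s‖))
    ((by fun_prop : Continuous fun s : ℝ => Real.exp (-(2 * K₀ * (b - s)))).continuousOn.mul
      (continuousOn_const.add h.2.2.1.norm))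
  set M := Real.exp (-(2 * K₀ * (b - s₀))) * (1 + ρ + ‖γ s₀‖) with hM
  have hM0 : 0 ≤ M := by positivity
  have hle : ∀ r ∈ Icc a b, 1 + ρ + ‖γ r‖ ≤ M * Real.exp (2 * K₀ * (b - r)) := by
    intro r hr
    have h1 : Real.exp (-(2 * K₀ * (b - r))) * (1 + ρ + ‖γ r‖) ≤ M := hmax hr
    rwa [Real.exp_neg, inv_mul_le_iff₀ (Real.exp_pos _), mul_comm] at h1
  have hderiv : ∀ r ∈ uIcc s₀ b, HasDerivAt (fun r => -(M / 2) * Real.exp (2 * K₀ * (b - r)))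
      (K₀ * (M * Real.exp (2 * K₀ * (b - r)))) r := by
    intro r _
    have h1 : HasDerivAt (fun r : ℝ => 2 * K₀ * (b - r)) (2 * K₀ * (-1)) r :=
      ((hasDerivAt_id r).const_sub b).const_mul (2 * K₀)
    exact (h1.exp.const_mul (-(M / 2))).congr_deriv (by ring)
  have hcont : Continuous fun r : ℝ => K₀ * (M * Real.exp (2 * K₀ * (b - r))) := by fun_prop
  have hint : ‖γ b - γ s₀‖ ≤ M / 2 * Real.exp (2 * K₀ * (b - s₀)) - M / 2 := by
    rw [h.sub_eq_integral hU hf hs₀.1 hs₀.2 le_rfl]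
    refine (intervalIntegral.norm_integral_le_of_norm_le hs₀.2
      (Filter.Eventually.of_forall fun r hr => ?_) (hcont.intervalIntegrable _ _)).trans_eq ?_
    · have hr' : r ∈ Icc a b := ⟨hs₀.1.trans hr.1.le, hr.2⟩
      refine (hA1 _ _).trans (mul_le_mul_of_nonneg_left ?_ hK₀.le)
      linarith [hle r hr', hρ _ (h.2.1 r hr')]
    · rw [intervalIntegral.integral_eq_sub_of_hasDerivAt hderiv (hcont.intervalIntegrable _ _)]
      simp
      ring
  have hMA : M ≤ 2 * (1 + ρ + ‖γ b‖) := by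
    have h1 : ‖γ s₀‖ ≤ ‖γ b‖ + ‖γ b - γ s₀‖ := norm_le_norm_add_norm_sub _ _
    have h2 : M * Real.exp (2 * K₀ * (b - s₀)) = 1 + ρ + ‖γ s₀‖ := by
      rw [hM, mul_right_comm, ← Real.exp_add]
      simp
    have h3 : 1 ≤ Real.exp (2 * K₀ * (b - s₀)) :=
      Real.one_le_exp (mul_nonneg (by positivity) (sub_nonneg.2 hs₀.2))
    have h4 : M / 2 * Real.exp (2 * K₀ * (b - s₀)) ≤ 1 + ρ + ‖γ b‖ - M / 2 := by linarith
    have h5 : M / 2 ≤ M / 2 * Real.exp (2 * K₀ * (b - s₀)) :=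
      le_mul_of_one_le_right (by positivity) h3
    linarith [norm_nonneg (γ b)]
  calc ‖γ s‖ ≤ 1 + ρ + ‖γ s‖ := by linarith
    _ ≤ M * Real.exp (2 * K₀ * (b - s)) := hle s hs
    _ ≤ _ := by
      gcongr
      exact hs.1

end IsAdmissible

/-- Uniform first-order expansion, along admissible pairs ending at `x` at time `t`, of a function
that is differentiable at `(t, x)`. -/
theorem exists_forall_abs_sub_integral_le {n m : ℕ} {f : En n → En m → En n} {U : Set (En m)}
    (hU : IsCompact U) (hf : Continuous fun p : En n × En m => f p.1 p.2) {K₀ : ℝ} (hK₀ : 0 < K₀)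
    (hA1 : ∀ x u, ‖f x u‖ ≤ K₀ * (1 + ‖x‖ + ‖u‖)) {L : En n → En m → ℝ → ℝ}
    (hL : Continuous fun p : En n × En m × ℝ => L p.1 p.2.1 p.2.2) {W : ℝ × En n → ℝ}
    {D : ℝ × En n →L[ℝ] ℝ} {t : ℝ} {x : En n} (hW : HasFDerivAt W D (t, x)) {ε : ℝ}
    (hε : 0 < ε) :
    ∃ δ > 0, ∀ h, 0 < h → h < δ → ∀ u γ, IsAdmissible f U (t - h) t u γ → γ t = x →
      |W (t, x) - W (t - h, γ (t - h)) - (∫ s in (t - h)..t, L (γ s) (u s) s) -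
        ∫ s in (t - h)..t, (D (1, f x (u s)) - L x (u s) t)| ≤ ε * h := by
  obtain ⟨ρ, hρ⟩ := hU.isBounded.exists_norm_le
  set R : ℝ := 2 * (1 + |ρ| + ‖x‖) * Real.exp (2 * K₀) with hR
  set C : ℝ := K₀ * (1 + R + |ρ|) with hC
  have hR0 : 0 ≤ R := by positivity
  have hC0 : 0 ≤ C := by positivity
  set G : En n → En m → ℝ → ℝ := fun y v s => D (1, f y v) - L y v s with hG
  have hGc : Continuous fun p : En n × En m × ℝ => G p.1 p.2.1 p.2.2 :=
    (D.continuous.comp (continuous_const.prodMk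
      (hf.comp (continuous_fst.prodMk (continuous_fst.comp continuous_snd))))).sub hL
  set η : ℝ := ε / (2 * (1 + C)) with hη
  have hη0 : 0 < η := by positivity
  have hunif : ∀ᶠ q : ℝ × En n in nhds (t, x), ∀ v ∈ U, |G q.2 v q.1 - G x v t| < ε / 2 := by
    refine hU.eventually_forall_of_forall_eventually fun v _ => ?_
    have hc : Continuous fun z : (ℝ × En n) × En m => |G z.1.2 z.2 z.1.1 - G x z.2 t| := by
      have h1 : Continuous fun z : (ℝ × En n) × En m => G z.1.2 z.2 z.1.1 :=
        hGc.comp (by fun_prop : Continuous fun z : (ℝ × En n) × En m => (z.1.2, z.2, z.1.1))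
      have h2 : Continuous fun z : (ℝ × En n) × En m => G x z.2 t :=
        hGc.comp (by fun_prop : Continuous fun z : (ℝ × En n) × En m => (x, z.2, t))
      exact (h1.sub h2).abs
    refine hc.continuousAt.eventually_lt_const ?_
    simpa using half_pos hε
  have hdiff := hW.isLittleO.def hη0
  obtain ⟨r, hr0, hr⟩ := Metric.eventually_nhds_iff.1 (hunif.and hdiff)
  refine ⟨min 1 (r / (1 + C)), lt_min one_pos (by positivity), fun h h0 hlt u γ hγ hx => ?_⟩
  have h1 : h ≤ 1 := hlt.le.trans (min_le_left _ _)
  have hhr : (1 + C) * h < r := by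
    have := hlt.trans_le (min_le_right _ _)
    rwa [lt_div_iff₀ (by positivity), mul_comm] at this
  have hab : t - h ≤ t := by linarith
  have hγR : ∀ s ∈ Icc (t - h) t, ‖γ s‖ ≤ R := by
    intro s hs
    refine (hγ.norm_le hU hf hK₀ hA1 (fun v hv => (hρ v hv).trans (le_abs_self ρ)) hs).trans ?_
    have hexp : 2 * K₀ * (t - (t - h)) ≤ 2 * K₀ := by
      rw [sub_sub_cancel]
      exact mul_le_of_le_one_right (by positivity) h1
    rw [hx, hR]
    gcongr
  have hvel : ∀ s ∈ Icc (t - h) t, ‖f (γ s) (u s)‖ ≤ C := by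
    intro s hs
    refine (hA1 _ _).trans ?_
    rw [hC]
    gcongr
    · exact hγR s hs
    · exact (hρ _ (hγ.2.1 s hs)).trans (le_abs_self ρ)
  have hclose : ∀ s ∈ Icc (t - h) t, ‖(s, γ s) - (t, x)‖ ≤ (1 + C) * h := by
    intro s hs
    have hdist : ‖γ s - x‖ ≤ C * h := by
      rw [norm_sub_rev, ← hx, hγ.sub_eq_integral hU hf hs.1 hs.2 le_rfl]
      refine (intervalIntegral.norm_integral_le_of_norm_le_const (C := C) fun r hr => ?_).trans ?_
      · rw [uIoc_of_le hs.2] at hr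
        exact hvel r ⟨hs.1.trans hr.1.le, hr.2⟩
      · rw [abs_of_nonneg (sub_nonneg.2 hs.2)]
        gcongr
        linarith [hs.1]
    rw [Prod.mk_sub_mk, Prod.norm_mk, Real.norm_eq_abs, abs_sub_comm,
      abs_of_nonneg (sub_nonneg.2 hs.2)]
    refine max_le ?_ ?_ <;> nlinarith [hs.1, mul_nonneg hC0 h0.le]
  have hnear : ∀ s ∈ Icc (t - h) t, dist (s, γ s) (t, x) < r := fun s hs => by
    rw [dist_eq_norm]
    exact (hclose s hs).trans_lt hhr
  have hmem : t - h ∈ Icc (t - h) t := ⟨le_rfl, hab⟩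
  have hexp : |W (t, x) - W (t - h, γ (t - h)) - D (h, x - γ (t - h))| ≤ ε / 2 * h := by
    have h2 := (hr (hnear _ hmem)).2
    have h3 : D ((t - h, γ (t - h)) - (t, x)) = - D (h, x - γ (t - h)) := by
      rw [← map_neg]
      congr 1
      simp
    rw [h3, Real.norm_eq_abs, abs_sub_comm, sub_sub_eq_add_sub] at h2
    calc _ = |-D (h, x - γ (t - h)) + W (t, x) - W (t - h, γ (t - h))| := by congr 1; ring
      _ ≤ _ := h2
      _ ≤ η * ((1 + C) * h) := by gcongr; exact hclose _ hmem
      _ = ε / 2 * h := by rw [hη]; field_simp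
  have hfint := hγ.intervalIntegrable_velocity hU hf hab
  have hLint := hγ.intervalIntegrable hU hL hab
  have hGint := hγ.intervalIntegrable hU hGc hab
  have hGxint : IntervalIntegrable (fun s => G x (u s) t) volume (t - h) t :=
    hγ.intervalIntegrable (g := fun _ v _ => G x v t) hU
      (hGc.comp (by fun_prop : Continuous fun z : En n × En m × ℝ => (x, z.2.1, t))) hab
  have hD : D (h, x - γ (t - h)) = ∫ s in (t - h)..t, D (1, f (γ s) (u s)) := by
    have hpair : IntervalIntegrable (fun s => ((1 : ℝ), f (γ s) (u s))) volume (t - h) t :=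
      hγ.intervalIntegrable (g := fun y v _ => ((1 : ℝ), f y v)) hU (continuous_const.prodMk
        (hf.comp (continuous_fst.prodMk (continuous_fst.comp continuous_snd)))) hab
    rw [D.intervalIntegral_comp_comm hpair, ← hx, hγ.sub_eq_integral hU hf le_rfl hab le_rfl]
    congr 1
    have e1 := (ContinuousLinearMap.fst ℝ ℝ (En n)).intervalIntegral_comp_comm hpair
    have e2 := (ContinuousLinearMap.snd ℝ ℝ (En n)).intervalIntegral_comp_comm hpair
    refine Prod.ext ?_ ?_
    · simpa using e1
    · simpa using e2
  have hsum : D (h, x - γ (t - h)) - (∫ s in (t - h)..t, L (γ s) (u s) s) -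
      (∫ s in (t - h)..t, G x (u s) t) =
        ∫ s in (t - h)..t, (G (γ s) (u s) s - G x (u s) t) := by
    rw [intervalIntegral.integral_sub hGint hGxint, hD, hG,
      ← intervalIntegral.integral_sub _ hLint]
    exact hγ.intervalIntegrable (g := fun y v _ => D (1, f y v)) hU (D.continuous.comp
      (continuous_const.prodMk
        (hf.comp (continuous_fst.prodMk (continuous_fst.comp continuous_snd))))) hab
  have hrem : |∫ s in (t - h)..t, (G (γ s) (u s) s - G x (u s) t)| ≤ ε / 2 * h := by
    have := intervalIntegral.norm_integral_le_of_norm_le_const (a := t - h) (b := t)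
      (f := fun s => G (γ s) (u s) s - G x (u s) t) (C := ε / 2) fun s hs => by
        rw [uIoc_of_le hab] at hs
        have hs' := Ioc_subset_Icc_self hs
        exact ((hr (hnear s hs')).1 (u s) (hγ.2.1 s hs')).le
    rwa [sub_sub_cancel, abs_of_pos h0] at this
  rw [← hsum] at hrem
  refine (abs_le.2 ⟨?_, ?_⟩) <;> linarith [abs_le.1 hexp, abs_le.1 hrem]

section ValueFunction

variable {n m : ℕ} {f : En n → En m → En n} {U : Set (En m)} {L : En n → En m → ℝ → ℝ}
  {I : En n → ℝ} {T t : ℝ}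

/-- The attainable costs for a given terminal state are bounded below. -/
theorem bddBelow_costs (hU : IsCompact U) (hf : Continuous fun p : En n × En m => f p.1 p.2)
    {K₀ : ℝ} (hK₀ : 0 < K₀) (hA1 : ∀ x u, ‖f x u‖ ≤ K₀ * (1 + ‖x‖ + ‖u‖))
    (hL : Continuous fun p : En n × En m × ℝ => L p.1 p.2.1 p.2.2) (hI : Continuous I)
    (hLb : ∃ C : ℝ, ∀ x u t, u ∈ U → t ∈ Icc (0:ℝ) T → -C ≤ L x u t)
    (ht0 : 0 ≤ t) (htT : t ≤ T) (x : En n) :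
    BddBelow { J | ∃ u γ, IsAdmissible f U 0 t u γ ∧ γ t = x ∧
      J = (∫ s in (0:ℝ)..t, L (γ s) (u s) s) + I (γ 0) } := by
  obtain ⟨C, hC⟩ := hLb
  obtain ⟨ρ, hρ⟩ := hU.isBounded.exists_norm_le
  obtain ⟨B, hB⟩ := ((isCompact_closedBall (0 : En n)
    (2 * (1 + ρ + ‖x‖) * Real.exp (2 * K₀ * (t - 0)))).image hI).bddBelow
  refine ⟨t * -C + B, ?_⟩
  rintro _ ⟨u, γ, hγ, hx, rfl⟩
  refine add_le_add ?_ (hB (mem_image_of_mem I ?_))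
  · have := intervalIntegral.integral_mono_on (f := fun _ => -C) ht0 intervalIntegrable_const
      (hγ.intervalIntegrable hU hL ht0) fun s hs =>
        hC (γ s) (u s) s (hγ.2.1 s hs) ⟨hs.1, hs.2.trans htT⟩
    simpa using this
  · rw [mem_closedBall_zero_iff, ← hx]
    exact hγ.norm_le hU hf hK₀ hA1 hρ ⟨le_rfl, ht0⟩

/-- Dynamic programming: the value grows along an admissible pair by at most the running cost. -/
theorem valueFun_le_add_integral (hU : IsCompact U) (hUne : U.Nonempty)
    (hf : Continuous fun p : En n × En m => f p.1 p.2)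
    {K₀ K₁ : ℝ} (hK₀ : 0 < K₀) (hA1 : ∀ x u, ‖f x u‖ ≤ K₀ * (1 + ‖x‖ + ‖u‖))
    (hK₁ : 0 < K₁) (hA2 : ∀ x₁ x₂ u, u ∈ U → ‖f x₂ u - f x₁ u‖ ≤ K₁ * ‖x₂ - x₁‖)
    (hL : Continuous fun p : En n × En m × ℝ => L p.1 p.2.1 p.2.2) (hI : Continuous I)
    (hLb : ∃ C : ℝ, ∀ x u t, u ∈ U → t ∈ Icc (0:ℝ) T → -C ≤ L x u t)
    {s : ℝ} (hs0 : 0 ≤ s) (hst : s ≤ t) (htT : t ≤ T) {u : ℝ → En m} {γ : ℝ → En n}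
    (h : IsAdmissible f U s t u γ) :
    valueFun f U L I t (γ t) ≤ valueFun f U L I s (γ s) + ∫ r in s..t, L (γ r) (u r) r := by
  refine le_of_forall_pos_le_add fun ε hε => ?_
  obtain ⟨u₀, γ₀, h₀, hγ₀⟩ := exists_isAdmissible hU hUne hf hK₀ hA1 hK₁ hA2 hs0 (γ s)
  obtain ⟨_, ⟨u₁, γ₁, h₁, hγ₁, rfl⟩, hlt⟩ := exists_lt_of_csInf_lt
    (by exact ⟨_, u₀, γ₀, h₀, hγ₀, rfl⟩)
    (lt_add_of_pos_right (valueFun f U L I s (γ s)) hε)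
  obtain ⟨v, ζ, hζ, hl, hr, hend⟩ := h₁.exists_glue h hU hf hs0 hst hγ₁
  have hle : valueFun f U L I t (γ t) ≤ (∫ r in (0:ℝ)..t, L (ζ r) (v r) r) + I (ζ 0) :=
    csInf_le (bddBelow_costs hU hf hK₀ hA1 hL hI hLb (hs0.trans hst) htT _)
      ⟨v, ζ, hζ, hend, rfl⟩
  have e₁ : ∫ r in (0:ℝ)..s, L (ζ r) (v r) r = ∫ r in (0:ℝ)..s, L (γ₁ r) (u₁ r) r := by
    refine intervalIntegral.integral_congr fun r hrs => ?_
    rw [uIcc_of_le hs0] at hrs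
    obtain ⟨h1, h2⟩ := hl r hrs.2
    simp only [h1, h2]
  have e₂ : ∫ r in s..t, L (ζ r) (v r) r = ∫ r in s..t, L (γ r) (u r) r := by
    refine intervalIntegral.integral_congr_ae (Filter.Eventually.of_forall fun r hrs => ?_)
    rw [uIoc_of_le hst] at hrs
    obtain ⟨h1, h2⟩ := hr r hrs.1
    simp only [h1, h2]
  rw [← intervalIntegral.integral_add_adjacent_intervals
    ((hζ.mono_right hst).intervalIntegrable hU hL hs0)
    ((hζ.mono_left hU hf hs0).intervalIntegrable hU hL hst), e₁, e₂, (hl 0 hs0).2] at hle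
  linarith

/-- Dynamic programming: along a nearly optimal pair, every tail is nearly optimal. -/
theorem exists_valueFun_add_integral_le (hU : IsCompact U) (hUne : U.Nonempty)
    (hf : Continuous fun p : En n × En m => f p.1 p.2)
    {K₀ K₁ : ℝ} (hK₀ : 0 < K₀) (hA1 : ∀ x u, ‖f x u‖ ≤ K₀ * (1 + ‖x‖ + ‖u‖))
    (hK₁ : 0 < K₁) (hA2 : ∀ x₁ x₂ u, u ∈ U → ‖f x₂ u - f x₁ u‖ ≤ K₁ * ‖x₂ - x₁‖)
    (hL : Continuous fun p : En n × En m × ℝ => L p.1 p.2.1 p.2.2) (hI : Continuous I)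
    (hLb : ∃ C : ℝ, ∀ x u t, u ∈ U → t ∈ Icc (0:ℝ) T → -C ≤ L x u t)
    (ht0 : 0 ≤ t) (htT : t ≤ T) (x : En n) {ε : ℝ} (hε : 0 < ε) :
    ∃ u γ, IsAdmissible f U 0 t u γ ∧ γ t = x ∧ ∀ s ∈ Icc 0 t,
      valueFun f U L I s (γ s) + (∫ r in s..t, L (γ r) (u r) r) ≤ valueFun f U L I t x + ε := by
  obtain ⟨u₀, γ₀, h₀, hγ₀⟩ := exists_isAdmissible hU hUne hf hK₀ hA1 hK₁ hA2 ht0 x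
  obtain ⟨_, ⟨u, γ, h, hγ, rfl⟩, hlt⟩ := exists_lt_of_csInf_lt
    (by exact ⟨_, u₀, γ₀, h₀, hγ₀, rfl⟩)
    (lt_add_of_pos_right (valueFun f U L I t x) hε)
  refine ⟨u, γ, h, hγ, fun s hs => ?_⟩
  have hle : valueFun f U L I s (γ s) ≤ (∫ r in (0:ℝ)..s, L (γ r) (u r) r) + I (γ 0) :=
    csInf_le (bddBelow_costs hU hf hK₀ hA1 hL hI hLb hs.1 (hs.2.trans htT) _)
      ⟨u, γ, h.mono_right hs.2, rfl, rfl⟩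
  rw [← intervalIntegral.integral_add_adjacent_intervals
    ((h.mono_right hs.2).intervalIntegrable hU hL hs.1)
    ((h.mono_left hU hf hs.1).intervalIntegrable hU hL hs.2)] at hlt
  linarith

theorem valueFun_zero (hUne : U.Nonempty) (x : En n) : valueFun f U L I 0 x = I x := by
  obtain ⟨v, hv⟩ := hUne
  have : { J | ∃ u γ, IsAdmissible f U 0 0 u γ ∧ γ 0 = x ∧
      J = (∫ s in (0:ℝ)..0, L (γ s) (u s) s) + I (γ 0) } = {I x} := by
    ext J
    constructor
    · rintro ⟨u, γ, -, hx, rfl⟩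
      simp [hx]
    · rintro rfl
      refine ⟨fun _ => v, fun _ => x, ⟨measurable_const, fun _ _ => hv, continuousOn_const, ?_⟩,
        rfl, by simp⟩
      intro s hs
      obtain rfl : s = 0 := le_antisymm hs.2 hs.1
      simp
  rw [valueFun, this, csInf_singleton]

/-- The Hamilton–Jacobi–Bellman equation holds wherever the value function is differentiable. -/
theorem deriv_add_ham_eq_zero (hU : IsCompact U) (hUne : U.Nonempty)
    (hf : Continuous fun p : En n × En m => f p.1 p.2)
    {K₀ K₁ : ℝ} (hK₀ : 0 < K₀) (hA1 : ∀ x u, ‖f x u‖ ≤ K₀ * (1 + ‖x‖ + ‖u‖))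
    (hK₁ : 0 < K₁) (hA2 : ∀ x₁ x₂ u, u ∈ U → ‖f x₂ u - f x₁ u‖ ≤ K₁ * ‖x₂ - x₁‖)
    (hL : Continuous fun p : En n × En m × ℝ => L p.1 p.2.1 p.2.2) (hI : Continuous I)
    (hLb : ∃ C : ℝ, ∀ x u t, u ∈ U → t ∈ Icc (0:ℝ) T → -C ≤ L x u t)
    (ht : 0 < t) (htT : t ≤ T) (x : En n)
    (hV : DifferentiableAt ℝ (fun p : ℝ × En n => valueFun f U L I p.1 p.2) (t, x)) :
    deriv (fun τ => valueFun f U L I τ x) t +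
      ham f U L x (gradient (valueFun f U L I t) x) t = 0 := by
  obtain ⟨D, hD⟩ := hV
  have hDt : deriv (fun τ => valueFun f U L I τ x) t = D (1, 0) :=
    (hD.comp_hasDerivAt (f := fun τ => (τ, x)) t
      ((hasDerivAt_id t).prodMk (hasDerivAt_const t x))).deriv
  have hDx : ∀ w, ⟪gradient (valueFun f U L I t) x, w⟫ = D (0, w) := by
    intro w
    have h1 : HasFDerivAt (valueFun f U L I t) (D.comp (ContinuousLinearMap.inr ℝ ℝ (En n))) x :=
      hD.comp (f := fun y => (t, y)) x (hasFDerivAt_prodMk_right t x)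
    rw [gradient, InnerProductSpace.toDual_symm_apply, h1.fderiv]
    simp
  have hsplit : ∀ w, D (1, w) = D (1, 0) + D (0, w) := fun w => by
    rw [← map_add]
    simp
  set S : Set ℝ := { r | ∃ v ∈ U, r = ⟪gradient (valueFun f U L I t) x, f x v⟫ - L x v t }
  have hSne : S.Nonempty := let ⟨v, hv⟩ := hUne; ⟨_, v, hv, rfl⟩
  have hGle : ∀ v ∈ U, D (1, f x v) - L x v t ≤ 0 := by
    intro v hv
    refine le_of_forall_pos_le_add fun ε hε => ?_
    obtain ⟨δ, hδ, hexp⟩ := exists_forall_abs_sub_integral_le hU hf hK₀ hA1 hL hD hε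
    obtain ⟨h, h0, hh⟩ := exists_between (lt_min hδ (lt_min ht
      (by positivity : 0 < 1 / (2 * K₀))))
    rw [lt_min_iff, lt_min_iff, lt_div_iff₀ (by positivity)] at hh
    obtain ⟨γ, hγ, hx⟩ := exists_isAdmissible_const hK₀ hA1 hK₁ hA2 hv (sub_le_self t h0.le)
      (by rw [sub_sub_cancel]; linarith) x
    have h1 := (abs_le.1 (hexp h h0 hh.1 _ γ hγ hx)).1
    have h2 := valueFun_le_add_integral hU hUne hf hK₀ hA1 hK₁ hA2 hL hI hLb
      (sub_nonneg.2 hh.2.1.le) (sub_le_self t h0.le) htT hγ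
    rw [hx] at h2
    simp only [intervalIntegral.integral_const, sub_sub_cancel, smul_eq_mul] at h1
    have h3 : h * (D (1, f x v) - L x v t) ≤ h * (0 + ε) := by linarith
    exact le_of_mul_le_mul_left h3 h0
  have hbound : ∀ r ∈ S, r ≤ -D (1, 0) := by
    rintro _ ⟨v, hv, rfl⟩
    rw [hDx]
    linarith [hGle v hv, hsplit (f x v)]
  rw [hDt]
  change D (1, 0) + sSup S = 0
  refine le_antisymm (by linarith [csSup_le hSne hbound]) ?_
  refine le_of_forall_pos_le_add fun ε hε => ?_
  obtain ⟨δ, hδ, hexp⟩ := exists_forall_abs_sub_integral_le hU hf hK₀ hA1 hL hD (half_pos hε)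
  obtain ⟨h, h0, hh⟩ := exists_between (lt_min hδ ht)
  rw [lt_min_iff] at hh
  have hth : t - h ≤ t := sub_le_self t h0.le
  obtain ⟨u, γ, hγ, hx, hopt⟩ := exists_valueFun_add_integral_le hU hUne hf hK₀ hA1 hK₁ hA2
    hL hI hLb ht.le htT x (mul_pos (half_pos hε) h0)
  have hγ' := hγ.mono_left hU hf (sub_nonneg.2 hh.2.le)
  have h1 := (abs_le.1 (hexp h h0 hh.1 u γ hγ' hx)).2
  have h2 := hopt (t - h) ⟨sub_nonneg.2 hh.2.le, hth⟩
  have hint : IntervalIntegrable (fun s => D (1, f x (u s)) - L x (u s) t) volume (t - h) t :=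
    hγ'.intervalIntegrable (g := fun _ v _ => D (1, f x v) - L x v t) hU
      ((D.continuous.comp (continuous_const.prodMk (hf.comp
        (by fun_prop : Continuous fun z : En n × En m × ℝ => (x, z.2.1))))).sub
        (hL.comp (by fun_prop : Continuous fun z : En n × En m × ℝ => (x, z.2.1, t)))) hth
  have h3 := intervalIntegral.integral_mono_on (g := fun _ => D (1, 0) + sSup S) hth hint
    intervalIntegrable_const fun s hs => by
      have := le_csSup ⟨_, hbound⟩ ⟨u s, hγ'.2.1 s hs, rfl⟩
      rw [hDx] at this
      linarith [hsplit (f x (u s))]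
  simp only [intervalIntegral.integral_const, sub_sub_cancel, smul_eq_mul] at h3
  have h4 : h * 0 ≤ h * (D (1, 0) + sSup S + ε) := by linarith
  exact le_of_mul_le_mul_left h4 h0

end ValueFunction

/-- If the value function is `C¹` on `(0,T) × ℝⁿ`, then it satisfies the
Hamilton–Jacobi–Bellman equation in the classical sense, together with the
initial condition `V(0,x) = I(x)`. -/
theorem value_function_classical_HJB {n m : ℕ} (T : ℝ) (hT : 0 < T)
    (U : Set (En m)) (hU : IsCompact U) (hUne : U.Nonempty)
    (f : En n → En m → En n)
    (hf : Continuous fun p : En n × En m => f p.1 p.2)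
    (K₀ : ℝ) (hK₀ : 0 < K₀)
    (hA1 : ∀ x u, ‖f x u‖ ≤ K₀ * (1 + ‖x‖ + ‖u‖))
    (K₁ : ℝ) (hK₁ : 0 < K₁)
    (hA2 : ∀ x₁ x₂ u, u ∈ U → ‖f x₂ u - f x₁ u‖ ≤ K₁ * ‖x₂ - x₁‖)
    (L : En n → En m → ℝ → ℝ)
    (hL : Continuous fun p : En n × En m × ℝ => L p.1 p.2.1 p.2.2)
    (hL1 : ∀ K : ℝ, ∃ C : ℝ, ∀ x u t, u ∈ U → t ∈ Icc (0:ℝ) T →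
      K * ‖u‖ - C ≤ L x u t)
    (hL2 : ∀ R > (0:ℝ), ∃ α : ℝ, ∀ x₁ x₂ u t, ‖x₁‖ ≤ R → ‖x₂‖ ≤ R → u ∈ U →
      t ∈ Icc (0:ℝ) T → |L x₂ u t - L x₁ u t| ≤ α * ‖x₂ - x₁‖)
    (hLu : ∃ C : ℝ, ∀ x u₁ u₂ t, u₁ ∈ U → u₂ ∈ U → t ∈ Icc (0:ℝ) T →
      |L x u₁ t - L x u₂ t| ≤ C * ‖u₁ - u₂‖)
    (I : En n → ℝ) (hI : Continuous I)
    (hV : ContDiffOn ℝ 1 (fun p : ℝ × En n => valueFun f U L I p.1 p.2)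
      (Ioo (0:ℝ) T ×ˢ univ)) :
    (∀ t ∈ Ioo (0:ℝ) T, ∀ x : En n,
      deriv (fun τ => valueFun f U L I τ x) t +
        ham f U L x (gradient (valueFun f U L I t) x) t = 0) ∧
    (∀ x : En n, valueFun f U L I 0 x = I x) := by
  refine ⟨fun t ht x => ?_, valueFun_zero hUne⟩
  have hLb : ∃ C : ℝ, ∀ x u t, u ∈ U → t ∈ Icc (0:ℝ) T → -C ≤ L x u t := by
    simpa using hL1 0
  exact deriv_add_ham_eq_zero hU hUne hf hK₀ hA1 hK₁ hA2 hL hI hLb ht.1 ht.2.le x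
    ((hV.contDiffAt ((isOpen_Ioo.prod isOpen_univ).mem_nhds ⟨ht, mem_univ x⟩)).differentiableAt
      one_ne_zero)
end
end
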